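/- Let c = c_n be the n-cycle s_{n−1}⋯s_2s_1. Consider the endomorphism of ℂW (as a right ℂW-module) given by left multiplication by e_n. Its kernel {x ∈ ℂW : e_n x = 0} is the free right ℂW_{n−1}-module with basis {c^k − b⁺(n−1,k) : 1 ≤ k ≤ n−1}; that is, the (n−1)·(n−1)! elements (c^k − b⁺(n−1,k))·w, for 1 ≤ k ≤ n−1 and w ∈ W_{n−1}, form a ℂ-basis of the kernel. Moreover, {e_n w : w ∈ W_{n−1}} is a ℂ-basis of E_n = e_n ℂW, so the map ℂW_{n−1} → E_n, a ↦ e_n a, is an isomorphism of right ℂW_{n−1}-modules; in particular E_n is the right regular ℂW_{n−1}-module and dim E_n = (n−1)!. -/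

import Mathlib

open scoped Classical
open MonoidAlgebra Finset Equiv

noncomputable section

namespace DPRSym

variable (n : ℕ)

/-- The simple reflection `s_i` (1-based, `1 ≤ i ≤ n-1`) of the symmetric group
`S_n = Perm (Fin n)`: the transposition of the (0-based) points `i-1` and `i`. -/
def sgen (i : ℕ) : Equiv.Perm (Fin n) :=
  if h : 0 < i ∧ i < n then Equiv.swap ⟨i - 1, by omega⟩ ⟨i, h.2⟩ else 1

/-- The Coxeter generating set `S = {s_1, …, s_{n-1}}` of `S_n`. -/
def Simples : Finset (Equiv.Perm (Fin n)) := (Finset.Icc 1 (n - 1)).image (sgen n)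

/-- The Coxeter length of a permutation: the length of a shortest word in the
generators `S` expressing it. -/
def len (w : Equiv.Perm (Fin n)) : ℕ :=
  sInf {k | ∃ L : List (Equiv.Perm (Fin n)),
    (∀ x ∈ L, x ∈ Simples n) ∧ L.length = k ∧ L.prod = w}

/-- The `i`-cycle `c_i = s_{i-1} ⋯ s_2 s_1` (with `c_1 = 1`). -/
def cgen (i : ℕ) : Equiv.Perm (Fin n) :=
  (((List.range (i - 1)).reverse).map (fun j => sgen n (j + 1))).prod

/-- The set `W^I` of minimal length left coset representatives of `W_I`,
computed inside the subset `H` (take `H = Set.univ` for the absolute case). -/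
def minCoset (H : Set (Equiv.Perm (Fin n))) (I : Finset (Equiv.Perm (Fin n))) :
    Finset (Equiv.Perm (Fin n)) :=
  Finset.univ.filter (fun w => w ∈ H ∧ ∀ s ∈ I, len n w < len n (w * s))

/-- The element `x_I = ∑_{w ∈ W^I} w` of the group algebra. -/
def xRel (H : Set (Equiv.Perm (Fin n))) (I : Finset (Equiv.Perm (Fin n))) :
    MonoidAlgebra ℂ (Equiv.Perm (Fin n)) :=
  ∑ w ∈ minCoset n H I, of ℂ (Equiv.Perm (Fin n)) w

/-- `w(Δ_J) ⊆ Δ_D`: for every `s ∈ J`, `wsw⁻¹ ∈ D` and `ℓ(ws) = ℓ(w) + 1`. -/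
def Takes (D : Finset (Equiv.Perm (Fin n))) (w : Equiv.Perm (Fin n))
    (J : Finset (Equiv.Perm (Fin n))) : Prop :=
  ∀ s ∈ J, w * s * w⁻¹ ∈ D ∧ len n (w * s) = len n w + 1

/-- `ᵂJ = wJw⁻¹`. -/
def conjF (w : Equiv.Perm (Fin n)) (J : Finset (Equiv.Perm (Fin n))) :
    Finset (Equiv.Perm (Fin n)) :=
  J.image (fun s => w * s * w⁻¹)

/-- The coefficient `m_{JK}` (for `σ ≡ 1`: the number of `w ∈ W^K` with
`w(Δ_J) ⊆ Δ`), relative to the pair `(H, D)`. -/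
def mC (H : Set (Equiv.Perm (Fin n))) (D : Finset (Equiv.Perm (Fin n)))
    (J K : Finset (Equiv.Perm (Fin n))) : ℕ :=
  if J ⊆ K then ((minCoset n H K).filter (fun w => Takes n D w J)).card else 0

/-- The family `(e_J)` of BBHT quasi-idempotents for `σ ≡ 1`, relative to `(H, D)`:
the unique solution of the triangular system `x_K = ∑_{J ⊆ K} m_{JK} e_J`, `K ⊆ D`. -/
def IsBBHT (H : Set (Equiv.Perm (Fin n))) (D : Finset (Equiv.Perm (Fin n)))
    (e : Finset (Equiv.Perm (Fin n)) → MonoidAlgebra ℂ (Equiv.Perm (Fin n))) : Prop :=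
  ∀ K ∈ D.powerset, xRel n H K = ∑ J ∈ K.powerset, (mC n H D J K : ℂ) • e J

/-- `b⁺(m, k)`: the coefficient of `t^k` in `(1 - c_1 t)(1 - c_2 t) ⋯ (1 - c_m t)`,
a polynomial with coefficients in the group algebra `ℂ S_n`. -/
def bplus (m k : ℕ) : MonoidAlgebra ℂ (Equiv.Perm (Fin n)) :=
  (((List.range m).map (fun i =>
      1 - Polynomial.C (of ℂ (Equiv.Perm (Fin n)) (cgen n (i + 1))) * Polynomial.X)).prod).coeff k

/-- The transposition of the 0-based points `a` and `b` (junk value `1` if out of range). -/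
def fswap (a b : ℕ) : Equiv.Perm (Fin n) :=
  if h : a < n ∧ b < n then Equiv.swap ⟨a, h.1⟩ ⟨b, h.2⟩ else 1

section Length

/-- The simple reflection exchanging the adjacent points `j` and `j + 1`. -/
def adj {m : ℕ} (j : Fin m) : Equiv.Perm (Fin (m + 1)) := Equiv.swap j.castSucc j.succ

/-- The number of inversions of a permutation. -/
def invCount {m : ℕ} (w : Equiv.Perm (Fin m)) : ℕ :=
  (univ.filter fun p : Fin m × Fin m => p.1 < p.2 ∧ w p.2 < w p.1).card

lemma sgen_succ {m : ℕ} (j : Fin m) : sgen (m + 1) (j + 1) = adj j := by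
  unfold sgen adj
  rw [dif_pos ⟨by omega, by omega⟩]
  rfl

lemma sgen_eq_adj {m i : ℕ} (h1 : 1 ≤ i) (h2 : i ≤ m) :
    sgen (m + 1) i = adj ⟨i - 1, by omega⟩ := by
  rw [← sgen_succ]
  simp only
  congr 1
  omega

lemma adj_injective {m : ℕ} : Function.Injective (adj : Fin m → Equiv.Perm (Fin (m + 1))) := by
  intro i j h
  by_contra hij
  have h1 := congrArg (fun f : Equiv.Perm (Fin (m + 1)) => f i.castSucc) h
  simp only [adj, Equiv.swap_apply_left] at h1
  rw [Equiv.swap_apply_def] at h1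
  split_ifs at h1 with h2 h3
  · exact hij (Fin.castSucc_injective _ h2)
  · simp only [Fin.ext_iff, Fin.val_succ, Fin.val_castSucc] at h1 h3
    omega
  · simp only [Fin.ext_iff, Fin.val_succ, Fin.val_castSucc] at h1
    omega

lemma Simples_succ (m : ℕ) : Simples (m + 1) = univ.image (adj : Fin m → _) := by
  ext x
  simp only [Simples, Finset.mem_image, Finset.mem_Icc, Finset.mem_univ, true_and]
  constructor
  · rintro ⟨i, ⟨h1, h2⟩, rfl⟩
    exact ⟨⟨i - 1, by omega⟩, (sgen_eq_adj h1 (by omega)).symm⟩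
  · rintro ⟨j, rfl⟩
    exact ⟨j + 1, ⟨by omega, by have := j.2; omega⟩, sgen_succ j⟩

lemma adj_mem_Simples {m : ℕ} (j : Fin m) : adj j ∈ Simples (m + 1) := by
  simp [Simples_succ]

lemma adj_mul_self {m : ℕ} (j : Fin m) : adj j * adj j = 1 := Equiv.swap_mul_self _ _

lemma adj_lt_adj {m : ℕ} {j : Fin m} {a b : Fin (m + 1)} (hab : a < b)
    (h : ¬(a = j.castSucc ∧ b = j.succ)) : adj j a < adj j b := by
  unfold adj
  rw [Equiv.swap_apply_def, Equiv.swap_apply_def]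
  split_ifs <;> simp only [Fin.ext_iff, Fin.lt_def, Fin.val_succ, Fin.val_castSucc] at * <;> omega

lemma invCount_mul_adj {m : ℕ} (w : Equiv.Perm (Fin (m + 1))) (j : Fin m)
    (h : w j.castSucc < w j.succ) : invCount (w * adj j) = invCount w + 1 := by
  unfold invCount
  have key : (univ.filter fun p : Fin (m + 1) × Fin (m + 1) =>
        p.1 < p.2 ∧ (w * adj j) p.2 < (w * adj j) p.1)
      = insert (j.castSucc, j.succ) ((univ.filter fun p : Fin (m + 1) × Fin (m + 1) =>
        p.1 < p.2 ∧ w p.2 < w p.1).image (Prod.map (adj j) (adj j))) := by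
    ext ⟨a, b⟩
    simp only [Finset.mem_filter, Finset.mem_univ, true_and, Finset.mem_insert, Finset.mem_image,
      Prod.mk.injEq, Prod.map_apply, Prod.exists]
    simp only [Equiv.Perm.mul_apply]
    constructor
    · rintro ⟨h1, h2⟩
      by_cases hab : a = j.castSucc ∧ b = j.succ
      · exact Or.inl hab
      · refine Or.inr ⟨adj j a, adj j b, ⟨adj_lt_adj h1 hab, h2⟩, ?_, ?_⟩
        · rw [← Equiv.Perm.mul_apply, adj_mul_self, Equiv.Perm.one_apply]
        · rw [← Equiv.Perm.mul_apply, adj_mul_self, Equiv.Perm.one_apply]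
    · rintro (⟨rfl, rfl⟩ | ⟨a, b, ⟨h1, h2⟩, rfl, rfl⟩)
      · refine ⟨Fin.castSucc_lt_succ, ?_⟩
        simpa [adj] using h
      · refine ⟨adj_lt_adj h1 ?_, ?_⟩
        · rintro ⟨rfl, rfl⟩
          exact absurd h2 (not_lt.2 h.le)
        · have h3 (x) : adj j (adj j x) = x := Equiv.swap_apply_self _ _ _
          rwa [h3, h3]
  rw [key, Finset.card_insert_of_notMem, Finset.card_image_of_injective]
  · exact (adj j).injective.prodMap (adj j).injective
  · simp only [Finset.mem_image, Finset.mem_filter, Finset.mem_univ, true_and, Prod.map_apply,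
      Prod.mk.injEq, Prod.exists, not_exists, not_and]
    rintro a b ⟨h1, -⟩ h3 h4
    have h5 : a = j.succ := by
      apply (adj j).injective
      rw [h3]
      simp [adj]
    have h6 : b = j.castSucc := by
      apply (adj j).injective
      rw [h4]
      simp [adj]
    rw [h5, h6] at h1
    exact absurd h1 (not_lt.2 (Fin.castSucc_lt_succ).le)

lemma invCount_mul_adj_of_gt {m : ℕ} (w : Equiv.Perm (Fin (m + 1))) (j : Fin m)
    (h : w j.succ < w j.castSucc) : invCount w = invCount (w * adj j) + 1 := by
  have := invCount_mul_adj (w * adj j) j (by simpa [adj] using h)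
  rwa [mul_assoc, adj_mul_self, mul_one] at this

lemma apply_castSucc_lt_or_gt {m : ℕ} (w : Equiv.Perm (Fin (m + 1))) (j : Fin m) :
    w j.castSucc < w j.succ ∨ w j.succ < w j.castSucc := by
  apply lt_or_gt_of_ne
  intro h
  exact (Fin.castSucc_lt_succ (i := j)).ne (w.injective h)

lemma invCount_one {m : ℕ} : invCount (1 : Equiv.Perm (Fin m)) = 0 := by
  unfold invCount
  rw [Finset.card_eq_zero, Finset.filter_eq_empty_iff]
  rintro ⟨a, b⟩ - ⟨h1, h2⟩
  exact absurd h1 (not_lt.2 (le_of_lt h2))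

lemma invCount_prod_le {m : ℕ} (L : List (Equiv.Perm (Fin (m + 1))))
    (hL : ∀ x ∈ L, x ∈ Simples (m + 1)) : invCount L.prod ≤ L.length := by
  induction L using List.reverseRecOn with
  | nil => simp [invCount_one]
  | append_singleton L x ih =>
    have h1 := ih fun x hx => hL x (by simp [hx])
    have h2 := hL x (by simp)
    rw [Simples_succ] at h2
    obtain ⟨j, -, rfl⟩ := Finset.mem_image.1 h2
    simp only [List.prod_append, List.prod_singleton, List.length_append, List.length_singleton]
    rcases apply_castSucc_lt_or_gt L.prod j with h | h
    · rw [invCount_mul_adj _ _ h]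
      omega
    · have := invCount_mul_adj_of_gt _ _ h
      omega

lemma eq_one_of_forall_lt {m : ℕ} (w : Equiv.Perm (Fin (m + 1)))
    (h : ∀ j : Fin m, w j.castSucc < w j.succ) : w = 1 := by
  have h1 : StrictMono w := Fin.strictMono_iff_lt_succ.2 h
  exact (Equiv.Perm.monotone_iff w).1 h1.monotone

lemma exists_word {m : ℕ} (k : ℕ) : ∀ w : Equiv.Perm (Fin (m + 1)), invCount w = k →
    ∃ L : List (Equiv.Perm (Fin (m + 1))),
      (∀ x ∈ L, x ∈ Simples (m + 1)) ∧ L.length = k ∧ L.prod = w := by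
  induction k with
  | zero =>
    intro w hw
    refine ⟨[], by simp, rfl, ?_⟩
    rw [List.prod_nil, eq_comm]
    apply eq_one_of_forall_lt
    intro j
    rcases apply_castSucc_lt_or_gt w j with h | h
    · exact h
    · have := invCount_mul_adj_of_gt _ _ h
      omega
  | succ k ih =>
    intro w hw
    have : ∃ j : Fin m, w j.succ < w j.castSucc := by
      by_contra hcon
      push Not at hcon
      have h1 : w = 1 := by
        apply eq_one_of_forall_lt
        intro j
        rcases apply_castSucc_lt_or_gt w j with h | h
        · exact h
        · exact absurd h (not_lt.2 (hcon j))
      rw [h1, invCount_one] at hw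
      omega
    obtain ⟨j, hj⟩ := this
    have h2 := invCount_mul_adj_of_gt _ _ hj
    obtain ⟨L, h3, h4, h5⟩ := ih (w * adj j) (by omega)
    refine ⟨L ++ [adj j], ?_, by simp [h4], ?_⟩
    · intro x hx
      rcases List.mem_append.1 hx with hx | hx
      · exact h3 x hx
      · rw [List.mem_singleton.1 hx]
        exact adj_mem_Simples j
    · rw [List.prod_append, h5, List.prod_singleton, mul_assoc, adj_mul_self, mul_one]

lemma len_eq_invCount {m : ℕ} (w : Equiv.Perm (Fin (m + 1))) : len (m + 1) w = invCount w := by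
  unfold len
  apply le_antisymm
  · exact Nat.sInf_le (exists_word _ w rfl)
  · refine le_csInf ⟨invCount w, exists_word _ w rfl⟩ fun k hk => ?_
    obtain ⟨L, h1, h2, h3⟩ := hk
    rw [← h2, ← h3]
    exact invCount_prod_le L h1

lemma len_lt_len_mul_adj_iff {m : ℕ} (w : Equiv.Perm (Fin (m + 1))) (j : Fin m) :
    len (m + 1) w < len (m + 1) (w * adj j) ↔ w j.castSucc < w j.succ := by
  rw [len_eq_invCount, len_eq_invCount]
  rcases apply_castSucc_lt_or_gt w j with h | h
  · simp [invCount_mul_adj _ _ h, h]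
  · have := invCount_mul_adj_of_gt _ _ h
    refine iff_of_false (by omega) (not_lt.2 h.le)

lemma len_mul_adj_eq_iff {m : ℕ} (w : Equiv.Perm (Fin (m + 1))) (j : Fin m) :
    len (m + 1) (w * adj j) = len (m + 1) w + 1 ↔ w j.castSucc < w j.succ := by
  constructor
  · intro h
    rw [← len_lt_len_mul_adj_iff]
    omega
  · intro h
    rw [len_eq_invCount, len_eq_invCount, invCount_mul_adj _ _ h]

lemma conj_adj_mem_Simples_iff {m : ℕ} (w : Equiv.Perm (Fin (m + 1))) (j : Fin m)
    (h : w j.castSucc < w j.succ) :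
    w * adj j * w⁻¹ ∈ Simples (m + 1) ↔ (w j.succ : ℕ) = w j.castSucc + 1 := by
  have h1 : w * adj j * w⁻¹ = Equiv.swap (w j.castSucc) (w j.succ) := by
    rw [adj, Equiv.swap_apply_apply]
  rw [h1, Simples_succ]
  simp only [Finset.mem_image, Finset.mem_univ, true_and]
  constructor
  · rintro ⟨i, hi⟩
    have h2 := congrArg (fun f : Equiv.Perm (Fin (m + 1)) => f (w j.castSucc)) hi
    simp only [Equiv.swap_apply_left, adj] at h2
    rw [Equiv.swap_apply_def] at h2
    split_ifs at h2 with h3 h4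
    · rw [← h2, h3]
      simp
    · rw [h4, ← h2] at h
      exact absurd h (not_lt.2 (Fin.castSucc_lt_succ).le)
    · exact absurd h2 h.ne
  · intro h2
    refine ⟨⟨w j.castSucc, by have := (w j.succ).2; omega⟩, ?_⟩
    unfold adj
    congr 1
    apply Fin.ext
    simp [h2]

end Length

section Counting

open Polynomial in
/-- The polynomial whose value at `q` is the binomial coefficient `q + a` over `p`. -/
def chPoly (a p : ℕ) : Polynomial ℂ :=
  Polynomial.C ((p.factorial : ℂ)⁻¹) * (descPochhammer ℂ p).comp (X + Polynomial.C (a : ℂ))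

lemma chPoly_eval (a p q : ℕ) : (chPoly a p).eval (q : ℂ) = ((q + a).choose p : ℂ) := by
  have h : (p.factorial : ℂ) ≠ 0 := by exact_mod_cast p.factorial_ne_zero
  simp only [chPoly, Polynomial.eval_mul, Polynomial.eval_C, Polynomial.eval_comp,
    Polynomial.eval_add, Polynomial.eval_X]
  rw [← Nat.cast_add, descPochhammer_eval_eq_descFactorial,
    Nat.descFactorial_eq_factorial_mul_choose]
  push_cast
  field_simp

lemma chPoly_coeff_zero {a p : ℕ} (h : a < p) : (chPoly a p).coeff 0 = 0 := by
  rw [Polynomial.coeff_zero_eq_eval_zero]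
  have := chPoly_eval a p 0
  rw [Nat.cast_zero] at this
  rw [this, Nat.choose_eq_zero_of_lt (by omega), Nat.cast_zero]

lemma polynomial_eq_of_eval_nat {p r : Polynomial ℂ}
    (h : ∀ q : ℕ, p.eval (q : ℂ) = r.eval (q : ℂ)) : p = r := by
  apply Polynomial.eq_of_infinite_eval_eq
  apply (Set.infinite_range_of_injective (Nat.cast_injective (R := ℂ))).mono
  rintro _ ⟨q, rfl⟩
  exact h q

lemma sum_powerset_chPoly {α : Type*} (A : Finset α) (p : ℕ) (h : A.card ≤ p) :
    ∑ K ∈ A.powerset, chPoly 0 (p - K.card) = chPoly A.card p := by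
  apply polynomial_eq_of_eval_nat
  intro q
  rw [Polynomial.eval_finsetSum, chPoly_eval]
  simp only [chPoly_eval, add_zero]
  rw [Finset.sum_powerset_apply_card (fun k => ((q.choose (p - k) : ℕ) : ℂ)), add_comm q,
    Nat.add_choose_eq, Finset.Nat.sum_antidiagonal_eq_sum_range_succ_mk]
  push_cast
  rw [Finset.sum_subset (Finset.range_mono (by omega : A.card + 1 ≤ p + 1))]
  · simp
  · intro x _ hx
    rw [Nat.choose_eq_zero_of_lt (by simpa using hx), zero_smul]

lemma chPoly_self_coeff_one (m : ℕ) : (chPoly m (m + 1)).coeff 1 = ((m : ℂ) + 1)⁻¹ := by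
  have h1 : chPoly m (m + 1)
      = Polynomial.C (((m + 1).factorial : ℂ)⁻¹) * ascPochhammer ℂ (m + 1) := by
    apply polynomial_eq_of_eval_nat
    intro q
    rw [chPoly_eval, Polynomial.eval_mul, Polynomial.eval_C, ascPochhammer_nat_eq_natCast_ascFactorial,
      Nat.ascFactorial_eq_factorial_mul_choose']
    have h : ((m + 1).factorial : ℂ) ≠ 0 := by exact_mod_cast (m + 1).factorial_ne_zero
    push_cast
    field_simp
    rfl
  rw [h1, ascPochhammer_succ_left, Polynomial.coeff_C_mul, Polynomial.coeff_X_mul,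
    Polynomial.coeff_zero_eq_eval_zero, Polynomial.eval_comp]
  simp only [Polynomial.eval_add, Polynomial.eval_X, Polynomial.eval_one, zero_add,
    ascPochhammer_eval_one]
  have h : (m.factorial : ℂ) ≠ 0 := by exact_mod_cast m.factorial_ne_zero
  have h' : (m : ℂ) + 1 ≠ 0 := by exact_mod_cast m.succ_ne_zero
  rw [Nat.factorial_succ]
  push_cast
  field_simp

/-- The number of ascents of a sequence. -/
def ascCount {α : Type*} [LinearOrder α] {m : ℕ} (y : Fin (m + 1) → α) : ℕ :=
  (univ.filter fun j : Fin m => y j.castSucc < y j.succ).card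

lemma ascCount_le {α : Type*} [LinearOrder α] {m : ℕ} (y : Fin (m + 1) → α) : ascCount y ≤ m := by
  unfold ascCount
  exact (Finset.card_le_univ _).trans (by simp)

lemma card_strictMono (k N : ℕ) :
    (univ.filter fun f : Fin k → Fin N => StrictMono f).card = N.choose k := by
  have h : (univ.filter fun f : Fin k → Fin N => StrictMono f).card
      = (Finset.powersetCard k (univ : Finset (Fin N))).card := by
    apply Finset.card_bij (fun f _ => univ.image f)
    · intro f hf
      rw [Finset.mem_filter] at hf
      rw [Finset.mem_powersetCard]
      refine ⟨Finset.subset_univ _, ?_⟩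
      rw [Finset.card_image_of_injective _ hf.2.injective, Finset.card_univ, Fintype.card_fin]
    · intro f hf g hg hfg
      rw [Finset.mem_filter] at hf hg
      apply (StrictMono.range_inj hf.2 hg.2).1
      simpa using congrArg (fun s : Finset (Fin N) => (s : Set (Fin N))) hfg
    · intro s hs
      have h2 := (Finset.mem_powersetCard.1 hs).2
      refine ⟨s.orderEmbOfFin h2, ?_, ?_⟩
      · rw [Finset.mem_filter]
        exact ⟨Finset.mem_univ _, (s.orderEmbOfFin h2).strictMono⟩
      · apply Finset.coe_injective
        simp
  rw [h, Finset.card_powersetCard, Finset.card_univ, Fintype.card_fin]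

/-- The number of ascents of a sequence strictly before the position `i`. -/
def ascBefore {α : Type*} [LinearOrder α] {m : ℕ} (y : Fin (m + 1) → α) (i : Fin (m + 1)) : ℕ :=
  (univ.filter fun j : Fin m => j.castSucc < i ∧ y j.castSucc < y j.succ).card

lemma ascBefore_succ {α : Type*} [LinearOrder α] {m : ℕ} (y : Fin (m + 1) → α) (j : Fin m) :
    ascBefore y j.succ
      = ascBefore y j.castSucc + if y j.castSucc < y j.succ then 1 else 0 := by
  unfold ascBefore
  have h : ∀ i : Fin m, i.castSucc < j.succ ↔ i.castSucc < j.castSucc ∨ i = j := by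
    intro i
    simp only [Fin.lt_def, Fin.ext_iff, Fin.val_succ, Fin.val_castSucc]
    omega
  split_ifs with hj
  · rw [← Finset.card_insert_of_notMem (a := j) (by simp)]
    congr 1
    ext i
    simp only [Finset.mem_filter, Finset.mem_univ, true_and, Finset.mem_insert, h]
    constructor
    · rintro ⟨h1 | h1, h2⟩
      · exact Or.inr ⟨h1, h2⟩
      · exact Or.inl h1
    · rintro (rfl | ⟨h1, h2⟩)
      · exact ⟨Or.inr rfl, hj⟩
      · exact ⟨Or.inl h1, h2⟩
  · rw [add_zero]
    congr 1
    ext i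
    simp only [Finset.mem_filter, Finset.mem_univ, true_and, h]
    constructor
    · rintro ⟨h1 | rfl, h2⟩
      · exact ⟨h1, h2⟩
      · exact absurd h2 hj
    · rintro ⟨h1, h2⟩
      exact ⟨Or.inl h1, h2⟩

lemma ascBefore_zero {α : Type*} [LinearOrder α] {m : ℕ} (y : Fin (m + 1) → α) :
    ascBefore y 0 = 0 := by
  simp [ascBefore]

lemma ascBefore_last {α : Type*} [LinearOrder α] {m : ℕ} (y : Fin (m + 1) → α) :
    ascBefore y (Fin.last m) = ascCount y := by
  simp [ascBefore, ascCount, Fin.castSucc_lt_last]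

lemma ascBefore_le {α : Type*} [LinearOrder α] {m : ℕ} (y : Fin (m + 1) → α) (i : Fin (m + 1)) :
    ascBefore y i ≤ ascCount y := by
  apply Finset.card_le_card
  intro j hj
  rw [Finset.mem_filter] at hj ⊢
  exact ⟨hj.1, hj.2.2⟩

lemma card_strictMono_toLex {α : Type*} [LinearOrder α] {m : ℕ} (y : Fin (m + 1) → α) (q : ℕ) :
    (univ.filter fun g : Fin (m + 1) → Fin q => StrictMono fun i => toLex (g i, y i)).card
      = (q + ascCount y).choose (m + 1) := by
  rw [← card_strictMono]
  have hlt : ∀ (g : Fin (m + 1) → Fin q) (i : Fin (m + 1)),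
      (g i : ℕ) + ascBefore y i < q + ascCount y := fun g i =>
    add_lt_add_of_lt_of_le (g i).2 (ascBefore_le y i)
  have hiff : ∀ g : Fin (m + 1) → Fin q, (StrictMono fun i => toLex (g i, y i)) ↔
      StrictMono fun i => (⟨g i + ascBefore y i, hlt g i⟩ : Fin (q + ascCount y)) := by
    intro g
    rw [Fin.strictMono_iff_lt_succ, Fin.strictMono_iff_lt_succ]
    apply forall_congr'
    intro j
    rw [Prod.Lex.toLex_lt_toLex, Fin.lt_def, Fin.lt_def, Fin.ext_iff]
    have hs := ascBefore_succ y j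
    simp only
    split_ifs at hs with hj
    · simp only [hj, and_true]
      omega
    · simp only [hj, and_false, or_false]
      omega
  apply Finset.card_bij (fun g _ i => (⟨g i + ascBefore y i, hlt g i⟩ : Fin (q + ascCount y)))
  · intro g hg
    rw [Finset.mem_filter] at hg ⊢
    exact ⟨Finset.mem_univ _, (hiff g).1 hg.2⟩
  · intro g _ g' _ h
    ext i
    have := congrFun h i
    rw [Fin.mk.injEq] at this
    omega
  · intro f hf
    rw [Finset.mem_filter] at hf
    have h1 := Fin.strictMono_iff_lt_succ.1 hf.2
    have hge : ∀ i, ascBefore y i ≤ f i := by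
      intro i
      induction i using Fin.induction with
      | zero => simp [ascBefore_zero]
      | succ j ih =>
        have h2 := Fin.lt_def.1 (h1 j)
        rw [ascBefore_succ]
        split_ifs <;> omega
    have hlt' : ∀ i, (f i : ℕ) < q + ascBefore y i := by
      intro i
      induction i using Fin.reverseInduction with
      | last =>
        rw [ascBefore_last]
        exact (f _).2
      | cast j ih =>
        have h2 := Fin.lt_def.1 (h1 j)
        rw [ascBefore_succ] at ih
        split_ifs at ih <;> omega
    have hf' : (fun i => (⟨((⟨f i - ascBefore y i, by have := hlt' i; have := hge i; omega⟩ :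
        Fin q) : ℕ) + ascBefore y i, by have := (f i).2; have := hge i; simp only; omega⟩ :
        Fin (q + ascCount y))) = f := by
      ext i
      have := hge i
      simp only
      omega
    refine ⟨fun i => ⟨f i - ascBefore y i, by have := hlt' i; have := hge i; omega⟩, ?_, hf'⟩
    rw [Finset.mem_filter]
    refine ⟨Finset.mem_univ _, (hiff _).2 ?_⟩
    rw [hf']
    exact hf.2

lemma existsUnique_sort {ι α : Type*} [Fintype ι] [LinearOrder α] {k : ℕ} (hk : Fintype.card ι = k)
    {κ : ι → α} (hκ : Function.Injective κ) : ∃! e : Fin k ≃ ι, StrictMono (κ ∘ e) := by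
  let e₀ : Fin k ≃ ι := (Fintype.equivFinOfCardEq hk).symm
  refine ⟨(Tuple.sort (κ ∘ e₀)).trans e₀, ?_, ?_⟩
  · have h := Tuple.monotone_sort (κ ∘ e₀)
    exact h.strictMono_of_injective
      ((hκ.comp e₀.injective).comp (Tuple.sort (κ ∘ e₀)).injective)
  · intro e he
    have h1 : (e.trans e₀.symm) = Tuple.sort (κ ∘ e₀) := by
      rw [Tuple.eq_sort_iff]
      have h2 : (κ ∘ e₀) ∘ (e.trans e₀.symm) = κ ∘ e := by
        ext i
        simp
      rw [h2]
      refine ⟨he.monotone, fun i j hij h => ?_⟩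
      have h3 := he hij
      simp only [Function.comp_apply, Equiv.trans_apply, Equiv.apply_symm_apply] at h h3
      exact absurd h h3.ne
    rw [← h1]
    ext i
    simp

/-- Counting functions constrained by a relation, by sorting the pairs `(g i, y i)`. -/
lemma card_filter_rel {ι α : Type*} [Fintype ι] [LinearOrder α] {m : ℕ}
    (hm : Fintype.card ι = m + 1) {y : ι → α} (hy : Function.Injective y) (R : ι → ι → Prop)
    (q : ℕ) :
    (univ.filter fun g : ι → Fin q => ∀ i j, R i j → toLex (g i, y i) < toLex (g j, y j)).card
      = ∑ e ∈ univ.filter (fun e : Fin (m + 1) ≃ ι => ∀ i j, R i j → e.symm i < e.symm j),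
          (q + ascCount (y ∘ e)).choose (m + 1) := by
  have hinj : ∀ g : ι → Fin q, Function.Injective fun i => toLex (g i, y i) := by
    intro g i j h
    exact hy (Prod.ext_iff.1 (toLex.injective h)).2
  have hfib : ∀ e : Fin (m + 1) ≃ ι,
      (univ.filter fun g : ι → Fin q => StrictMono ((fun i => toLex (g i, y i)) ∘ e)).card
        = (q + ascCount (y ∘ e)).choose (m + 1) := by
    intro e
    rw [← card_strictMono_toLex]
    apply Finset.card_equiv (Equiv.arrowCongr e.symm (Equiv.refl _))
    intro g
    simp only [Finset.mem_filter, Finset.mem_univ, true_and]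
    rfl
  rw [← Finset.sum_congr rfl fun e _ => hfib e, ← Finset.card_biUnion]
  · congr 1
    ext g
    simp only [Finset.mem_filter, Finset.mem_univ, true_and, Finset.mem_biUnion]
    constructor
    · intro h
      obtain ⟨e, he, -⟩ := existsUnique_sort hm (hinj g)
      refine ⟨e, fun i j hij => ?_, he⟩
      rw [← he.lt_iff_lt]
      simpa using h i j hij
    · rintro ⟨e, h, he⟩ i j hij
      have := he (h i j hij)
      simpa using this
  · intro e _ e' _ hne
    change Disjoint _ _
    rw [Finset.disjoint_left]
    intro g h1 h2
    rw [Finset.mem_filter] at h1 h2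
    exact hne ((existsUnique_sort hm (hinj g)).unique h1.2 h2.2)

lemma eval_sum_chPoly {ι α : Type*} [Fintype ι] [LinearOrder α] {m : ℕ}
    (hm : Fintype.card ι = m + 1) {y : ι → α} (hy : Function.Injective y) (R : ι → ι → Prop)
    (q : ℕ) :
    (∑ e ∈ univ.filter (fun e : Fin (m + 1) ≃ ι => ∀ i j, R i j → e.symm i < e.symm j),
        chPoly (ascCount (y ∘ e)) (m + 1)).eval (q : ℂ)
      = ((univ.filter fun g : ι → Fin q =>
          ∀ i j, R i j → toLex (g i, y i) < toLex (g j, y j)).card : ℂ) := by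
  rw [card_filter_rel hm hy, Polynomial.eval_finsetSum]
  push_cast
  exact Finset.sum_congr rfl fun e _ => chPoly_eval _ _ _

lemma exists_polynomial_card {ι α : Type*} [Fintype ι] [Nonempty ι] [LinearOrder α]
    {y : ι → α} (hy : Function.Injective y) (R : ι → ι → Prop) :
    ∃ p : Polynomial ℂ, p.coeff 0 = 0 ∧ ∀ q : ℕ, p.eval (q : ℂ)
      = ((univ.filter fun g : ι → Fin q =>
          ∀ i j, R i j → toLex (g i, y i) < toLex (g j, y j)).card : ℂ) := by
  obtain ⟨m, hm⟩ := Nat.exists_eq_succ_of_ne_zero (Fintype.card_ne_zero (α := ι))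
  refine ⟨_, ?_, eval_sum_chPoly hm hy R⟩
  rw [Polynomial.finsetSum_coeff]
  exact Finset.sum_eq_zero fun e _ => chPoly_coeff_zero (Nat.lt_succ_of_le (ascCount_le _))

/-- Orthogonality to products: if the relation `R` does not connect a nonempty proper subset with
its complement, then the sum over all permutations compatible with `R` vanishes. -/
lemma sum_coeff_one_eq_zero {α : Type*} [LinearOrder α] {m : ℕ} {y : Fin (m + 1) → α}
    (hy : Function.Injective y) (R : Fin (m + 1) → Fin (m + 1) → Prop) (P : Fin (m + 1) → Prop)
    (h1 : ∃ i, P i) (h2 : ∃ i, ¬ P i) (hR : ∀ i j, R i j → (P i ↔ P j)) :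
    ∑ e ∈ univ.filter (fun e : Equiv.Perm (Fin (m + 1)) => ∀ i j, R i j → e.symm i < e.symm j),
      (chPoly (ascCount (y ∘ e)) (m + 1)).coeff 1 = 0 := by
  have : Nonempty {i // P i} := let ⟨i, hi⟩ := h1; ⟨⟨i, hi⟩⟩
  have : Nonempty {i // ¬ P i} := let ⟨i, hi⟩ := h2; ⟨⟨i, hi⟩⟩
  obtain ⟨p₁, hp₁, hp₁'⟩ := exists_polynomial_card (ι := {i // P i}) (y := fun i => y i)
    (hy.comp Subtype.val_injective) (fun i j => R i j)
  obtain ⟨p₂, hp₂, hp₂'⟩ := exists_polynomial_card (ι := {i // ¬ P i}) (y := fun i => y i)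
    (hy.comp Subtype.val_injective) (fun i j => R i j)
  rw [← Polynomial.finsetSum_coeff]
  have : ∑ e ∈ univ.filter
      (fun e : Fin (m + 1) ≃ Fin (m + 1) => ∀ i j, R i j → e.symm i < e.symm j),
      chPoly (ascCount (y ∘ e)) (m + 1) = p₁ * p₂ := by
    apply polynomial_eq_of_eval_nat
    intro q
    have h3 := eval_sum_chPoly (Fintype.card_fin (m + 1)) hy R q
    rw [Polynomial.eval_mul, hp₁', hp₂', ← Nat.cast_mul, ← Finset.card_product]
    refine Eq.trans ?_ (h3.trans (congrArg Nat.cast ?_))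
    · congr!
    apply Finset.card_equiv (Equiv.piEquivPiSubtypeProd P fun _ => Fin q)
    intro g
    simp only [Finset.mem_filter, Finset.mem_univ, true_and, Finset.mem_product,
      Equiv.piEquivPiSubtypeProd_apply]
    constructor
    · intro h
      exact ⟨fun i j hij => h i j hij, fun i j hij => h i j hij⟩
    · rintro ⟨ha, hb⟩ i j hij
      by_cases hi : P i
      · exact ha ⟨i, hi⟩ ⟨j, (hR i j hij).1 hi⟩ hij
      · exact hb ⟨i, hi⟩ ⟨j, fun hj => hi ((hR i j hij).2 hj)⟩ hij
  erw [this]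
  rw [Polynomial.mul_coeff_one, hp₁, hp₂, zero_mul, mul_zero, add_zero]

lemma sum_perm_chPoly (m : ℕ) :
    ∑ e : Equiv.Perm (Fin (m + 1)), chPoly (ascCount e) (m + 1) = Polynomial.X ^ (m + 1) := by
  apply polynomial_eq_of_eval_nat
  intro q
  have h := eval_sum_chPoly (ι := Fin (m + 1)) (m := m) (by simp)
    (y := (id : Fin (m + 1) → Fin (m + 1))) Function.injective_id (fun _ _ => False) q
  simp only [false_imp_iff, implies_true, Finset.filter_true, Function.id_comp,
    Finset.card_univ] at h
  rw [Polynomial.eval_pow, Polynomial.eval_X]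
  refine Eq.trans ?_ (h.trans ?_)
  · congr!
  · rw [← Nat.cast_pow]
    congr 1
    convert Fintype.card_pi_const (Fin q) (m + 1) using 1
    · congr!
    · rw [Fintype.card_fin]

end Counting

section Blocks

lemma perm_eq_of_lt_iff {k : ℕ} {u v : Equiv.Perm (Fin k)} (h : ∀ i j, u i < u j ↔ v i < v j) :
    u = v := by
  have h1 : StrictMono (v * u⁻¹) := by
    intro a b hab
    have := h (u⁻¹ a) (u⁻¹ b)
    simpa [hab] using this
  have h2 := (Equiv.Perm.monotone_iff _).1 h1.monotone
  rw [mul_inv_eq_one] at h2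
  exact h2.symm

lemma exists_perm_lt_iff {α : Type*} [LinearOrder α] {k : ℕ} {κ : Fin k → α}
    (hκ : Function.Injective κ) :
    ∃ w : Equiv.Perm (Fin k), ∀ i j, w i < w j ↔ κ i < κ j := by
  obtain ⟨e, he, -⟩ := existsUnique_sort (Fintype.card_fin k) hκ
  refine ⟨e.symm, fun i j => ?_⟩
  rw [← he.lt_iff_lt]
  simp

/-- The index of the block containing `i`, when `Fin (m + 1)` is divided into intervals by the
positions `j ∉ J`. -/
def blockIdx {m : ℕ} (J : Finset (Fin m)) (i : Fin (m + 1)) : Fin (Jᶜ.card + 1) :=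
  ⟨(Jᶜ.filter fun j => j.castSucc < i).card, Nat.lt_succ_of_le (Finset.card_filter_le _ _)⟩

lemma blockIdx_mono {m : ℕ} (J : Finset (Fin m)) : Monotone (blockIdx J) := by
  intro a b hab
  rw [Fin.le_def]
  apply Finset.card_le_card
  intro j hj
  rw [Finset.mem_filter] at hj ⊢
  exact ⟨hj.1, hj.2.trans_le hab⟩

lemma blockIdx_zero {m : ℕ} (J : Finset (Fin m)) : blockIdx J 0 = 0 := by
  simp [blockIdx]

lemma filter_castSucc_lt_succ {m : ℕ} (J : Finset (Fin m)) (j : Fin m) :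
    (Jᶜ.filter fun i => i.castSucc < j.succ)
      = if j ∈ J then Jᶜ.filter (fun i => i.castSucc < j.castSucc)
        else insert j (Jᶜ.filter fun i => i.castSucc < j.castSucc) := by
  have h : ∀ i : Fin m, i.castSucc < j.succ ↔ i.castSucc < j.castSucc ∨ i = j := by
    intro i
    simp only [Fin.lt_def, Fin.ext_iff, Fin.val_succ, Fin.val_castSucc]
    omega
  ext i
  split_ifs with hj
  · simp only [Finset.mem_filter, h, Finset.mem_compl]
    constructor
    · rintro ⟨h1, h2 | rfl⟩
      · exact ⟨h1, h2⟩
      · exact absurd hj h1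
    · tauto
  · simp only [Finset.mem_filter, h, Finset.mem_compl, Finset.mem_insert]
    constructor
    · tauto
    · rintro (rfl | h1)
      · exact ⟨hj, Or.inr rfl⟩
      · tauto

lemma blockIdx_succ_of_mem {m : ℕ} {J : Finset (Fin m)} {j : Fin m} (hj : j ∈ J) :
    blockIdx J j.succ = blockIdx J j.castSucc := by
  rw [Fin.ext_iff]
  simp only [blockIdx]
  rw [filter_castSucc_lt_succ, if_pos hj]

lemma blockIdx_succ_of_notMem {m : ℕ} {J : Finset (Fin m)} {j : Fin m} (hj : j ∉ J) :
    (blockIdx J j.succ : ℕ) = blockIdx J j.castSucc + 1 := by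
  simp only [blockIdx]
  rw [filter_castSucc_lt_succ, if_neg hj, Finset.card_insert_of_notMem (by simp)]

/-- Numbering of the positions `j ∉ J` at which a new block starts. -/
def boundaryIdx {m : ℕ} (J : Finset (Fin m)) (j : {j // j ∈ Jᶜ}) : Fin Jᶜ.card :=
  ⟨blockIdx J j.1.castSucc, by
    have h1 := blockIdx_succ_of_notMem (Finset.mem_compl.1 j.2)
    have h2 := (blockIdx J j.1.succ).2
    omega⟩

lemma boundaryIdx_bijective {m : ℕ} (J : Finset (Fin m)) :
    Function.Bijective (boundaryIdx J) := by
  rw [Fintype.bijective_iff_injective_and_card]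
  refine ⟨?_, by simp only [Fintype.card_coe, Fintype.card_fin]⟩
  have key : ∀ a b : {j // j ∈ Jᶜ}, a < b → boundaryIdx J a < boundaryIdx J b := by
    intro a b hab
    have h1 := blockIdx_succ_of_notMem (Finset.mem_compl.1 a.2)
    have h2 : blockIdx J a.1.succ ≤ blockIdx J b.1.castSucc :=
      blockIdx_mono J (Fin.succ_le_castSucc_iff.2 hab)
    rw [Fin.le_def] at h2
    simp only [boundaryIdx, Fin.lt_def]
    omega
  exact (show StrictMono (boundaryIdx J) from key).injective

lemma blockIdx_surjective {m : ℕ} (J : Finset (Fin m)) : Function.Surjective (blockIdx J) := by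
  intro k
  induction k using Fin.cases with
  | zero => exact ⟨0, blockIdx_zero J⟩
  | succ k =>
    obtain ⟨j, rfl⟩ := (boundaryIdx_bijective J).2 k
    refine ⟨j.1.succ, Fin.ext ?_⟩
    rw [blockIdx_succ_of_notMem (Finset.mem_compl.1 j.2)]
    simp [boundaryIdx]

/-- Positions in a common block are connected by steps `j ∈ J`. -/
lemma blockIdx_induction {m : ℕ} {J : Finset (Fin m)} {Q : Fin (m + 1) → Fin (m + 1) → Prop}
    (refl : ∀ i, Q i i)
    (step : ∀ i, ∀ j ∈ J, blockIdx J i = blockIdx J j.castSucc → i ≤ j.castSucc →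
      Q i j.castSucc → Q i j.succ)
    (i j : Fin (m + 1)) (hij : i ≤ j) (h : blockIdx J i = blockIdx J j) : Q i j := by
  induction j using Fin.induction with
  | zero =>
    rw [Fin.le_zero_iff.1 hij]
    exact refl _
  | succ j ih =>
    rcases hij.eq_or_lt with rfl | hlt
    · exact refl _
    · have h1 : i ≤ j.castSucc := Fin.le_castSucc_iff.2 hlt
      have h2 := blockIdx_mono J h1
      have hj : j ∈ J := by
        by_contra hj
        have h3 := blockIdx_succ_of_notMem hj
        rw [Fin.ext_iff] at h
        rw [Fin.le_def] at h2
        omega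
      rw [blockIdx_succ_of_mem hj] at h
      exact step i j hj h h1 (ih h1 h)

/-- Permutations taking `j, j + 1` to consecutive values for every `j ∈ J`. -/
def consecutivePerms {m : ℕ} (J : Finset (Fin m)) : Finset (Equiv.Perm (Fin (m + 1))) :=
  univ.filter fun w => ∀ j ∈ J, (w j.succ : ℕ) = w j.castSucc + 1

lemma lt_iff_of_consecutive {m : ℕ} {J : Finset (Fin m)} {w : Equiv.Perm (Fin (m + 1))}
    (hw : w ∈ consecutivePerms J) {i j : Fin (m + 1)} (h : blockIdx J i = blockIdx J j) :
    w i < w j ↔ i < j := by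
  have key : ∀ i j : Fin (m + 1), i ≤ j → blockIdx J i = blockIdx J j → w i ≤ w j := by
    intro i j hij h
    refine blockIdx_induction (Q := fun i j => w i ≤ w j) (fun i => le_rfl) ?_ i j hij h
    intro i j hj _ _ h1
    have := (Finset.mem_filter.1 hw).2 j hj
    rw [Fin.le_def] at h1 ⊢
    omega
  constructor
  · intro h1
    by_contra h2
    exact absurd h1 (not_lt.2 (key j i (not_lt.1 h2) h.symm))
  · intro h1
    exact (key i j h1.le h).lt_of_ne fun h2 => h1.ne (w.injective h2)

lemma lt_congr_of_consecutive {m : ℕ} {J : Finset (Fin m)} {w : Equiv.Perm (Fin (m + 1))}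
    (hw : w ∈ consecutivePerms J) {k i j : Fin (m + 1)} (h : blockIdx J i = blockIdx J j)
    (hk : blockIdx J k ≠ blockIdx J i) : w k < w i ↔ w k < w j := by
  have key : ∀ i j : Fin (m + 1), i ≤ j → blockIdx J i = blockIdx J j →
      blockIdx J k ≠ blockIdx J i → (w k < w i ↔ w k < w j) := by
    intro i j hij h
    refine blockIdx_induction
      (Q := fun i j => blockIdx J k ≠ blockIdx J i → (w k < w i ↔ w k < w j))
      (fun i _ => Iff.rfl) ?_ i j hij h
    intro i j hj hij _ h1 h2
    rw [h1 h2]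
    have h3 := (Finset.mem_filter.1 hw).2 j hj
    have h4 : (w k : ℕ) ≠ w j.castSucc := by
      intro h5
      rw [w.injective (Fin.ext h5)] at h2
      exact h2 hij.symm
    rw [Fin.lt_def, Fin.lt_def]
    omega
  rcases le_total i j with hij | hij
  · exact key i j hij h hk
  · exact (key j i hij h.symm (h ▸ hk)).symm

lemma lt_congr_of_consecutive' {m : ℕ} {J : Finset (Fin m)} {w : Equiv.Perm (Fin (m + 1))}
    (hw : w ∈ consecutivePerms J) {i i' j j' : Fin (m + 1)} (hi : blockIdx J i = blockIdx J i')
    (hj : blockIdx J j = blockIdx J j') (h : blockIdx J i ≠ blockIdx J j) :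
    w i < w j ↔ w i' < w j' := by
  have hne : ∀ {a b : Fin (m + 1)}, blockIdx J a ≠ blockIdx J b → w a ≠ w b :=
    fun h1 h2 => h1 (congrArg _ (w.injective h2))
  rw [lt_congr_of_consecutive hw hj h]
  have h1 : blockIdx J j' ≠ blockIdx J i := fun h2 => h (h2.symm.trans hj.symm)
  have h2 : blockIdx J j' ≠ blockIdx J i' := fun h2 => h1 (h2.trans hi.symm)
  have h3 := lt_congr_of_consecutive hw hi h1
  constructor
  · intro h4
    exact (not_lt.1 fun h5 => absurd (h3.2 h5) (not_lt.2 h4.le)).lt_of_ne (hne h2).symm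
  · intro h4
    exact (not_lt.1 fun h5 => absurd (h3.1 h5) (not_lt.2 h4.le)).lt_of_ne (hne h1).symm

/-- Sums over permutations keeping the blocks of `J` together reduce to sums over permutations
of the blocks. -/
lemma sum_consecutivePerms {M : Type*} [AddCommMonoid M] {m : ℕ} (J : Finset (Fin m))
    (F : ℕ → M) :
    ∑ w ∈ consecutivePerms J, F (ascCount w)
      = ∑ π : Equiv.Perm (Fin (Jᶜ.card + 1)), F (J.card + ascCount π) := by
  have hκ : ∀ π : Equiv.Perm (Fin (Jᶜ.card + 1)),
      Function.Injective fun i : Fin (m + 1) => toLex (π (blockIdx J i), i) := by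
    intro π i j hij
    simpa using congrArg (fun x => (ofLex x).2) hij
  choose Ψ hΨ using fun π => exists_perm_lt_iff (hκ π)
  simp only [Prod.Lex.toLex_lt_toLex, EmbeddingLike.apply_eq_iff_eq] at hΨ
  symm
  refine Finset.sum_bij (fun π _ => Ψ π) ?_ ?_ ?_ ?_
  · intro π _
    refine Finset.mem_filter.2 ⟨Finset.mem_univ _, fun j hj => ?_⟩
    have hb := blockIdx_succ_of_mem hj
    have h1 : Ψ π j.castSucc < Ψ π j.succ :=
      (hΨ π _ _).2 (Or.inr ⟨hb.symm, Fin.castSucc_lt_succ⟩)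
    by_contra hne
    rw [Fin.lt_def] at h1
    have hx : (Ψ π j.castSucc : ℕ) + 1 < m + 1 := by have := (Ψ π j.succ).2; omega
    obtain ⟨i, hi⟩ := (Ψ π).surjective ⟨Ψ π j.castSucc + 1, hx⟩
    have h2 : Ψ π j.castSucc < Ψ π i := by rw [hi, Fin.lt_def]; simp
    have h3 : Ψ π i < Ψ π j.succ := by rw [hi, Fin.lt_def]; simp only; omega
    rw [hΨ] at h2 h3
    rw [hb] at h3
    rcases h2 with h2 | ⟨h2, h2'⟩
    · rcases h3 with h3 | ⟨h3, -⟩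
      · exact absurd h2 (not_lt.2 h3.le)
      · exact absurd h2 (by rw [h3]; exact lt_irrefl _)
    · rcases h3 with h3 | ⟨-, h3'⟩
      · exact absurd h3 (by rw [h2]; exact lt_irrefl _)
      · rw [Fin.lt_def, Fin.val_castSucc] at h2'
        rw [Fin.lt_def, Fin.val_succ] at h3'
        omega
  · intro π _ π' _ h
    apply perm_eq_of_lt_iff
    intro a b
    obtain ⟨i, rfl⟩ := blockIdx_surjective J a
    obtain ⟨j, rfl⟩ := blockIdx_surjective J b
    by_cases hij : blockIdx J i = blockIdx J j
    · rw [hij]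
      simp
    · have h1 := hΨ π i j
      have h2 := hΨ π' i j
      rw [h] at h1
      simp only [hij, false_and, or_false] at h1 h2
      rw [← h1, h2]
  · intro w hw
    obtain ⟨μ, hμ⟩ := (blockIdx_surjective J).hasRightInverse
    obtain ⟨π, hπ⟩ := exists_perm_lt_iff (w.injective.comp hμ.injective)
    refine ⟨π, Finset.mem_univ _, perm_eq_of_lt_iff fun i j => ?_⟩
    rw [hΨ, hπ]
    by_cases hij : blockIdx J i = blockIdx J j
    · rw [lt_iff_of_consecutive hw hij, hij]
      simp
    · simp only [hij, false_and, or_false, Function.comp_apply]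
      exact lt_congr_of_consecutive' hw (hμ _) (hμ _) (by rwa [hμ, hμ])
  · intro π _
    have hcs : ∀ j : {j // j ∈ Jᶜ}, blockIdx J j.1.castSucc = (boundaryIdx J j).castSucc :=
      fun j => Fin.ext rfl
    have hsucc : ∀ j : {j // j ∈ Jᶜ}, blockIdx J j.1.succ = (boundaryIdx J j).succ :=
      fun j => Fin.ext (blockIdx_succ_of_notMem (Finset.mem_compl.1 j.2))
    have hasc : ∀ j : {j // j ∈ Jᶜ}, Ψ π j.1.castSucc < Ψ π j.1.succ ↔
        π (boundaryIdx J j).castSucc < π (boundaryIdx J j).succ := by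
      intro j
      rw [hΨ, hcs, hsucc]
      simp [Fin.castSucc_lt_succ.ne]
    have hJ : J ⊆ univ.filter fun j : Fin m => Ψ π j.castSucc < Ψ π j.succ := by
      intro j hj
      rw [Finset.mem_filter, hΨ]
      exact ⟨Finset.mem_univ _, Or.inr ⟨(blockIdx_succ_of_mem hj).symm, Fin.castSucc_lt_succ⟩⟩
    congr 1
    unfold ascCount
    rw [← Finset.card_sdiff_add_card_eq_card hJ, add_comm]
    congr 1
    symm
    refine Finset.card_bij (fun j hj =>
      boundaryIdx J ⟨j, Finset.mem_compl.2 (Finset.mem_sdiff.1 hj).2⟩) ?_ ?_ ?_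
    · intro j hj
      rw [Finset.mem_sdiff, Finset.mem_filter] at hj
      exact Finset.mem_filter.2 ⟨Finset.mem_univ _, (hasc ⟨j, Finset.mem_compl.2 hj.2⟩).1 hj.1.2⟩
    · intro i hi j hj h
      exact congrArg Subtype.val ((boundaryIdx_bijective J).1 h)
    · intro k hk
      obtain ⟨j, rfl⟩ := (boundaryIdx_bijective J).2 k
      refine ⟨j, ?_, rfl⟩
      rw [Finset.mem_sdiff, Finset.mem_filter, hasc]
      exact ⟨⟨Finset.mem_univ _, (Finset.mem_filter.1 hk).2⟩, Finset.mem_compl.1 j.2⟩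

end Blocks

section Idempotent

/-- The positions at which `w` ascends. -/
def ascSet {m : ℕ} (w : Equiv.Perm (Fin (m + 1))) : Finset (Fin m) :=
  univ.filter fun j => w j.castSucc < w j.succ

lemma subset_ascSet_iff {m : ℕ} {K : Finset (Fin m)} {w : Equiv.Perm (Fin (m + 1))} :
    K ⊆ ascSet w ↔ ∀ j ∈ K, w j.castSucc < w j.succ := by
  simp [ascSet, Finset.subset_iff]

lemma minCoset_image_adj {m : ℕ} (K : Finset (Fin m)) :
    minCoset (m + 1) Set.univ (K.image adj) = univ.filter fun w => K ⊆ ascSet w := by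
  ext w
  simp [minCoset, subset_ascSet_iff, len_lt_len_mul_adj_iff]

lemma xRel_image_adj {m : ℕ} (K : Finset (Fin m)) :
    xRel (m + 1) Set.univ (K.image adj)
      = ∑ w ∈ univ.filter (fun w => K ⊆ ascSet w), of ℂ (Equiv.Perm (Fin (m + 1))) w := by
  rw [xRel, minCoset_image_adj]

lemma takes_image_adj_iff {m : ℕ} {J : Finset (Fin m)} {w : Equiv.Perm (Fin (m + 1))} :
    Takes (m + 1) (Simples (m + 1)) w (J.image adj) ↔ w ∈ consecutivePerms J := by
  simp only [Takes, Finset.forall_mem_image, consecutivePerms, Finset.mem_filter,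
    Finset.mem_univ, true_and]
  refine forall₂_congr fun j _ => ?_
  rw [len_mul_adj_eq_iff]
  constructor
  · rintro ⟨h1, h2⟩
    exact (conj_adj_mem_Simples_iff w j h2).1 h1
  · intro h
    have h2 : w j.castSucc < w j.succ := by
      rw [Fin.lt_def]
      omega
    exact ⟨(conj_adj_mem_Simples_iff w j h2).2 h, h2⟩

lemma mC_image_adj {m : ℕ} {J K : Finset (Fin m)} (h : J ⊆ K) :
    mC (m + 1) Set.univ (Simples (m + 1)) (J.image adj) (K.image adj)
      = ((consecutivePerms J).filter fun w => K ⊆ ascSet w).card := by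
  rw [mC, if_pos (Finset.image_subset_image h), minCoset_image_adj]
  congr 1
  ext w
  simp only [Finset.mem_filter, Finset.mem_univ, true_and, takes_image_adj_iff]
  tauto

lemma subset_ascSet_of_consecutive {m : ℕ} {J : Finset (Fin m)} {w : Equiv.Perm (Fin (m + 1))}
    (hw : w ∈ consecutivePerms J) : J ⊆ ascSet w := by
  rw [subset_ascSet_iff]
  intro j hj
  have := (Finset.mem_filter.1 hw).2 j hj
  rw [Fin.lt_def]
  omega

/-- The coefficient of `w` in the idempotent `e_n`. -/
def eulerCoeff {m : ℕ} (w : Equiv.Perm (Fin (m + 1))) : ℂ := (chPoly (ascCount w) (m + 1)).coeff 1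

/-- An explicit form of the idempotent `e_n`. -/
def eulerIdem (m : ℕ) : MonoidAlgebra ℂ (Equiv.Perm (Fin (m + 1))) :=
  ∑ w, eulerCoeff w • of ℂ (Equiv.Perm (Fin (m + 1))) w

lemma eulerIdem_eq_sum_xRel (m : ℕ) :
    eulerIdem m = ∑ K : Finset (Fin m),
      (chPoly 0 (m + 1 - K.card)).coeff 1 • xRel (m + 1) Set.univ (K.image adj) := by
  simp only [xRel_image_adj, Finset.smul_sum, Finset.sum_filter]
  rw [Finset.sum_comm, eulerIdem]
  refine Finset.sum_congr rfl fun w _ => ?_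
  have h : eulerCoeff w = ∑ K ∈ (ascSet w).powerset, (chPoly 0 (m + 1 - K.card)).coeff 1 := by
    rw [← Polynomial.finsetSum_coeff, sum_powerset_chPoly]
    · rfl
    · exact (ascCount_le w).trans (Nat.le_succ m)
  simp only [smul_ite, smul_zero]
  rw [h, Finset.sum_smul, ← Finset.sum_filter]
  refine Finset.sum_congr ?_ fun _ _ => rfl
  ext K
  simp

lemma sum_Icc_chPoly {m : ℕ} {J A : Finset (Fin m)} (h : J ⊆ A) :
    ∑ K ∈ univ.filter (fun K => J ⊆ K ∧ K ⊆ A), (chPoly 0 (m + 1 - K.card)).coeff 1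
      = (chPoly (A.card - J.card) (Jᶜ.card + 1)).coeff 1 := by
  have hJ : Jᶜ.card + J.card = m := by simp
  have h1 := sum_powerset_chPoly (A \ J) (Jᶜ.card + 1) (by
    refine (Finset.card_le_card fun j hj => ?_).trans (Nat.le_succ _)
    exact Finset.mem_compl.2 (Finset.mem_sdiff.1 hj).2)
  rw [Finset.card_sdiff_of_subset h] at h1
  rw [← h1, Polynomial.finsetSum_coeff]
  symm
  refine Finset.sum_bij (fun K _ => J ∪ K) ?_ ?_ ?_ ?_
  · intro K hK
    rw [Finset.mem_powerset] at hK
    exact Finset.mem_filter.2 ⟨Finset.mem_univ _, Finset.subset_union_left,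
      Finset.union_subset h (hK.trans Finset.sdiff_subset)⟩
  · intro K hK K' hK' hh
    rw [Finset.mem_powerset] at hK hK'
    have h2 : ∀ {L : Finset (Fin m)}, L ⊆ A \ J → (J ∪ L) \ J = L := fun hL => by
      rw [Finset.union_sdiff_left]
      exact Finset.sdiff_eq_self_of_disjoint
        (Finset.disjoint_left.2 fun j hj => (Finset.mem_sdiff.1 (hL hj)).2)
    rw [← h2 hK, ← h2 hK', hh]
  · intro K hK
    obtain ⟨-, h2, h3⟩ := Finset.mem_filter.1 hK
    exact ⟨K \ J, Finset.mem_powerset.2 (Finset.sdiff_subset_sdiff h3 le_rfl),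
      Finset.union_sdiff_of_subset h2⟩
  · intro K hK
    rw [Finset.mem_powerset] at hK
    rw [Finset.card_union_of_disjoint
      (Finset.disjoint_right.2 fun j hj => (Finset.mem_sdiff.1 (hK hj)).2)]
    congr 2
    omega

lemma sum_mC (m : ℕ) (J : Finset (Fin m)) :
    ∑ K ∈ univ.filter (fun K => J ⊆ K), (chPoly 0 (m + 1 - K.card)).coeff 1 *
        (mC (m + 1) Set.univ (Simples (m + 1)) (J.image adj) (K.image adj) : ℂ)
      = if J = univ then 1 else 0 := by
  calc _ = ∑ K ∈ univ.filter (fun K => J ⊆ K), ∑ w ∈ consecutivePerms J,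
        if K ⊆ ascSet w then (chPoly 0 (m + 1 - K.card)).coeff 1 else 0 := by
        refine Finset.sum_congr rfl fun K hK => ?_
        rw [mC_image_adj (Finset.mem_filter.1 hK).2, ← Finset.sum_filter, Finset.sum_const,
          nsmul_eq_mul, mul_comm]
    _ = ∑ w ∈ consecutivePerms J, (chPoly (ascCount w - J.card) (Jᶜ.card + 1)).coeff 1 := by
        rw [Finset.sum_comm]
        refine Finset.sum_congr rfl fun w hw => ?_
        rw [← Finset.sum_filter, Finset.filter_filter,
          sum_Icc_chPoly (subset_ascSet_of_consecutive hw)]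
        rfl
    _ = _ := by
        rw [sum_consecutivePerms J fun k => (chPoly (k - J.card) (Jᶜ.card + 1)).coeff 1]
        simp only [add_tsub_cancel_left]
        rw [← Polynomial.finsetSum_coeff, sum_perm_chPoly, Polynomial.coeff_X_pow]
        congr 1
        simp [Finset.card_eq_zero, Finset.compl_eq_empty_iff]

lemma powerset_image_adj {m : ℕ} (K : Finset (Fin m)) :
    (K.image adj).powerset = K.powerset.image (Finset.image adj) := by
  ext I
  simp only [Finset.mem_powerset, Finset.mem_image, Finset.subset_image_iff]

lemma IsBBHT.apply_Simples_eq {m : ℕ} {e : Finset (Equiv.Perm (Fin (m + 1))) → _}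
    (he : IsBBHT (m + 1) Set.univ (Simples (m + 1)) e) : e (Simples (m + 1)) = eulerIdem m := by
  have hinj : Function.Injective (Finset.image (adj : Fin m → _)) :=
    Finset.image_injective adj_injective
  have h : ∀ K : Finset (Fin m), xRel (m + 1) Set.univ (K.image adj) = ∑ J : Finset (Fin m),
      if J ⊆ K then (mC (m + 1) Set.univ (Simples (m + 1)) (J.image adj) (K.image adj) : ℂ) •
        e (J.image adj) else 0 := by
    intro K
    rw [he _ (Finset.mem_powerset.2 ?_), powerset_image_adj, Finset.sum_image hinj.injOn,
      ← Finset.sum_filter]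
    · refine Finset.sum_congr ?_ fun _ _ => rfl
      ext J
      simp
    · rw [Simples_succ]
      exact Finset.image_subset_image (Finset.subset_univ _)
  rw [eulerIdem_eq_sum_xRel]
  simp only [h, Finset.smul_sum, smul_ite, smul_zero, smul_smul]
  rw [Finset.sum_comm]
  simp only [← Finset.sum_filter, ← Finset.sum_smul, sum_mC]
  simp [Simples_succ]

end Idempotent

section Annihilation

lemma eulerIdem_mul_sum {m : ℕ} {V : Finset (Equiv.Perm (Fin (m + 1)))}
    (h : ∀ y, ∑ v ∈ V, eulerCoeff (y * v⁻¹) = 0) :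
    eulerIdem m * ∑ v ∈ V, of ℂ (Equiv.Perm (Fin (m + 1))) v = 0 := by
  have h1 : ∀ v, eulerIdem m * of ℂ (Equiv.Perm (Fin (m + 1))) v
      = ∑ y, eulerCoeff (y * v⁻¹) • of ℂ (Equiv.Perm (Fin (m + 1))) y := by
    intro v
    rw [eulerIdem, Finset.sum_mul]
    refine Fintype.sum_equiv (Equiv.mulRight v) _ _ fun w => ?_
    rw [Equiv.coe_mulRight, mul_inv_cancel_right, smul_mul_assoc, map_mul]
  rw [Finset.mul_sum]
  simp only [h1]
  rw [Finset.sum_comm]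
  simp only [← Finset.sum_smul, h, zero_smul, Finset.sum_const_zero]

lemma eulerIdem_mul_sum_filter {m : ℕ} (R : Fin (m + 1) → Fin (m + 1) → Prop)
    (P : Fin (m + 1) → Prop) (h1 : ∃ i, P i) (h2 : ∃ i, ¬ P i) (hR : ∀ i j, R i j → (P i ↔ P j)) :
    eulerIdem m * ∑ v ∈ univ.filter (fun v : Equiv.Perm (Fin (m + 1)) =>
      ∀ i j, R i j → v i < v j), of ℂ (Equiv.Perm (Fin (m + 1))) v = 0 := by
  apply eulerIdem_mul_sum
  intro y
  rw [← sum_coeff_one_eq_zero y.injective R P h1 h2 hR]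
  refine Finset.sum_bij (fun v _ => v⁻¹) ?_ ?_ ?_ ?_
  · intro v hv
    exact Finset.mem_filter.2 ⟨Finset.mem_univ _, (Finset.mem_filter.1 hv).2⟩
  · intro v _ v' _ h
    exact inv_injective h
  · intro v hv
    exact ⟨v⁻¹, Finset.mem_filter.2 ⟨Finset.mem_univ _, (Finset.mem_filter.1 hv).2⟩, inv_inv v⟩
  · intro v _
    rfl

lemma eulerIdem_mul_xRel {m : ℕ} {K : Finset (Fin m)} (hK : K ≠ univ) :
    eulerIdem m * xRel (m + 1) Set.univ (K.image adj) = 0 := by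
  obtain ⟨k, hk⟩ : ∃ k, k ∉ K := by
    by_contra h
    push Not at h
    exact hK (Finset.eq_univ_iff_forall.2 h)
  rw [xRel_image_adj]
  convert eulerIdem_mul_sum_filter (fun i j => ∃ l ∈ K, i = l.castSucc ∧ j = l.succ)
    (fun i => i ≤ k.castSucc) ⟨k.castSucc, le_rfl⟩
    ⟨k.succ, not_le.2 Fin.castSucc_lt_succ⟩ ?_ using 4 with w
  · rw [subset_ascSet_iff]
    constructor
    · rintro h _ _ ⟨l, hl, rfl, rfl⟩
      exact h l hl
    · intro h l hl
      exact h _ _ ⟨l, hl, rfl, rfl⟩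
  · rintro _ _ ⟨l, hl, rfl, rfl⟩
    have : (l : ℕ) ≠ k := fun h => hk (Fin.ext h ▸ hl)
    simp only [Fin.le_def, Fin.val_castSucc, Fin.val_succ]
    omega

lemma eulerIdem_mul_self (m : ℕ) : eulerIdem m * eulerIdem m = eulerIdem m := by
  have h : xRel (m + 1) Set.univ ((univ : Finset (Fin m)).image adj) = 1 := by
    rw [xRel_image_adj, Finset.sum_eq_single 1, map_one]
    · intro w hw hw1
      refine absurd (eq_one_of_forall_lt w fun j => ?_) hw1
      exact subset_ascSet_iff.1 (Finset.mem_filter.1 hw).2 j (Finset.mem_univ j)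
    · intro h
      refine absurd (Finset.mem_filter.2 ⟨Finset.mem_univ _, ?_⟩) h
      rw [subset_ascSet_iff]
      intro j _
      exact Fin.castSucc_lt_succ
  have h1 : (chPoly 0 1).coeff 1 = 1 := by simpa using chPoly_self_coeff_one 0
  conv_lhs => rw [eulerIdem_eq_sum_xRel m, Finset.mul_sum, ← eulerIdem_eq_sum_xRel]
  rw [Finset.sum_eq_single univ]
  · rw [h, mul_smul_comm, mul_one]
    simp [h1]
  · intro K _ hK
    rw [mul_smul_comm, eulerIdem_mul_xRel hK, smul_zero]
  · simp

end Annihilation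

section Cycles

lemma cgen_succ {m i : ℕ} (h1 : 1 ≤ i) :
    cgen (m + 1) (i + 1) = sgen (m + 1) i * cgen (m + 1) i := by
  obtain ⟨i, rfl⟩ := Nat.exists_eq_add_of_le' h1
  simp [cgen, List.range_succ]

lemma cgen_apply {m i : ℕ} (hi : i ≤ m) (x : Fin (m + 1)) :
    (cgen (m + 1) (i + 1) x : ℕ) = if (x : ℕ) = 0 then i else if (x : ℕ) ≤ i then x - 1 else x := by
  induction i with
  | zero =>
    simp only [cgen, add_tsub_cancel_right, List.range_zero, List.reverse_nil, List.map_nil,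
      List.prod_nil, Equiv.Perm.one_apply]
    split_ifs <;> omega
  | succ i ih =>
    have h1 := ih (by omega)
    rw [cgen_succ (by omega), sgen_eq_adj (by omega) hi, Equiv.Perm.mul_apply, adj,
      Equiv.swap_apply_def]
    split_ifs at h1 ⊢ with h2 h3 h4 h5 h6 h7 <;>
      simp only [Fin.ext_iff, Fin.val_castSucc, Fin.val_succ] at * <;> omega

lemma bplus_zero_right (n m : ℕ) : bplus n m 0 = 1 := by
  induction m with
  | zero => simp [bplus]
  | succ m ih =>
    rw [← ih]
    simp [bplus, List.range_succ, Polynomial.mul_coeff_zero]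

lemma bplus_zero_succ (n k : ℕ) : bplus n 0 (k + 1) = 0 := by
  simp [bplus, Polynomial.coeff_one]

lemma bplus_succ_succ (n m k : ℕ) : bplus n (m + 1) (k + 1)
    = bplus n m (k + 1) - bplus n m k * of ℂ (Equiv.Perm (Fin n)) (cgen n (m + 1)) := by
  unfold bplus
  rw [List.range_succ, List.map_append, List.prod_append, List.map_singleton, List.prod_singleton,
    mul_sub, mul_one, Polynomial.coeff_sub, ← mul_assoc, Polynomial.coeff_mul_X,
    Polynomial.coeff_mul_C]

/-- Permutations fixing all points `≥ p` which are decreasing on `[0, k)` and increasing after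
that. -/
def valleyPerms (m p k : ℕ) : Finset (Equiv.Perm (Fin (m + 1))) :=
  univ.filter fun v => k ≤ p ∧ (∀ i : Fin (m + 1), p ≤ (i : ℕ) → v i = i) ∧
    (∀ i j : Fin (m + 1), i < j → (j : ℕ) < k → v j < v i) ∧
    ∀ i j : Fin (m + 1), i < j → k ≤ (i : ℕ) → v i < v j

lemma valleyPerms_zero_right {m p : ℕ} : valleyPerms m p 0 = {1} := by
  ext v
  simp only [valleyPerms, Finset.mem_filter, Finset.mem_univ, true_and, Finset.mem_singleton]
  constructor
  · rintro ⟨-, -, -, h⟩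
    exact eq_one_of_forall_lt v fun j => h _ _ Fin.castSucc_lt_succ (Nat.zero_le _)
  · rintro rfl
    simp

lemma valleyPerms_zero_succ {m k : ℕ} : valleyPerms m 0 (k + 1) = ∅ := by
  ext v
  simp [valleyPerms]

lemma apply_lt_of_fixes {m p : ℕ} {v : Equiv.Perm (Fin (m + 1))}
    (h : ∀ i : Fin (m + 1), p ≤ (i : ℕ) → v i = i) {i : Fin (m + 1)} (hi : (i : ℕ) < p) :
    (v i : ℕ) < p := by
  by_contra h1
  rw [v.injective (h _ (not_lt.1 h1))] at h1
  exact h1 hi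

lemma valleyPerms_succ_succ {m p k : ℕ} (hp : p ≤ m) :
    valleyPerms m (p + 1) (k + 1) = valleyPerms m p (k + 1)
      ∪ (valleyPerms m p k).image (· * cgen (m + 1) (p + 1)) := by
  have hc := cgen_apply hp
  set c := cgen (m + 1) (p + 1)
  have hc0 : c 0 = ⟨p, by omega⟩ := Fin.ext (by rw [hc]; simp)
  have hc1 : ∀ (i : ℕ) (hi : i < p), c ⟨i + 1, by omega⟩ = ⟨i, by omega⟩ := by
    intro i hi
    apply Fin.ext
    rw [hc, if_neg (by simp), if_pos (by simp only; omega)]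
    simp
  have hc2 : ∀ i : Fin (m + 1), p < (i : ℕ) → c i = i := by
    intro i hi
    apply Fin.ext
    rw [hc, if_neg (by omega), if_neg (by omega)]
  ext v
  simp only [valleyPerms, Finset.mem_union, Finset.mem_image, Finset.mem_filter, Finset.mem_univ,
    true_and]
  constructor
  · rintro ⟨h1, h2, h3, h4⟩
    have hlt : ∀ {i : Fin (m + 1)}, (i : ℕ) < p + 1 → (v i : ℕ) < p + 1 := apply_lt_of_fixes h2
    by_cases hv : v 0 = ⟨p, by omega⟩
    · right
      have hu1 : ∀ (i : Fin (m + 1)) (hi : (i : ℕ) < p), (v * c⁻¹) i = v ⟨i + 1, by omega⟩ := by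
        intro i hi
        rw [Equiv.Perm.mul_apply, Equiv.Perm.inv_eq_iff_eq.2 (hc1 i hi).symm]
      have hu2 : ∀ i : Fin (m + 1), p ≤ (i : ℕ) → (v * c⁻¹) i = i := by
        intro i hi
        rw [Equiv.Perm.mul_apply]
        rcases hi.eq_or_lt with hi | hi
        · have : i = ⟨p, by omega⟩ := Fin.ext hi.symm
          rw [this, Equiv.Perm.inv_eq_iff_eq.2 hc0.symm, hv]
        · rw [Equiv.Perm.inv_eq_iff_eq.2 (hc2 i hi).symm, h2 i hi]
      refine ⟨v * c⁻¹, ⟨by omega, hu2, fun i j hij hj => ?_, fun i j hij hi => ?_⟩,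
        inv_mul_cancel_right _ _⟩
      · rw [Fin.lt_def] at hij
        rw [hu1 i (by omega), hu1 j (by omega)]
        exact h3 _ _ (by rw [Fin.lt_def]; simp only; omega) (by simp only; omega)
      · rw [Fin.lt_def] at hij
        by_cases hj : (j : ℕ) < p
        · rw [hu1 i (by omega), hu1 j hj]
          exact h4 _ _ (by rw [Fin.lt_def]; simp only; omega) (by simp only; omega)
        · rw [hu2 j (by omega)]
          by_cases hi' : (i : ℕ) < p
          · have := apply_lt_of_fixes hu2 hi'
            rw [Fin.lt_def]
            omega
          · rwa [hu2 i (by omega)]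
    · left
      obtain ⟨q, hq⟩ := v.surjective ⟨p, by omega⟩
      have hq0 : q ≠ 0 := fun h => hv (h ▸ hq)
      have hq1 : ¬ (q : ℕ) < k + 1 := by
        intro h
        have h5 := h3 0 q (Fin.pos_of_ne_zero hq0) h
        have h6 := hlt (i := 0) (by simp)
        rw [hq, Fin.lt_def] at h5
        simp only at h5
        omega
      have hq2 : (q : ℕ) = p := by
        rcases lt_trichotomy (q : ℕ) p with h | h | h
        · have h5 := h4 q ⟨p, by omega⟩ h (by omega)
          have h6 := hlt (i := ⟨p, by omega⟩) (by simp)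
          rw [hq, Fin.lt_def] at h5
          simp only at h5
          omega
        · exact h
        · rw [h2 q h] at hq
          simp [hq]
      refine ⟨by omega, fun i hi => ?_, h3, h4⟩
      rcases hi.eq_or_lt with hi | hi
      · have : i = q := Fin.ext (hi.symm.trans hq2.symm)
        rw [this, hq]
        exact Fin.ext hq2.symm
      · exact h2 i hi
  · rintro (⟨h1, h2, h3, h4⟩ | ⟨u, ⟨h1, h2, h3, h4⟩, rfl⟩)
    · exact ⟨by omega, fun i hi => h2 i (by omega), h3, h4⟩
    · have hlt : ∀ {i : Fin (m + 1)}, (i : ℕ) < p → (u i : ℕ) < p := apply_lt_of_fixes h2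
      have hv0 : (u * c) 0 = ⟨p, by omega⟩ := by
        rw [Equiv.Perm.mul_apply, hc0, h2 _ le_rfl]
      have hv1 : ∀ i : Fin (m + 1), i ≠ 0 → (i : ℕ) ≤ p → (u * c) i = u ⟨i - 1, by omega⟩ := by
        intro i h0 hi
        have h0' : (i : ℕ) ≠ 0 := fun h => h0 (Fin.ext h)
        have : i = ⟨(i - 1) + 1, by omega⟩ := Fin.ext (by simp only; omega)
        rw [Equiv.Perm.mul_apply]
        conv_lhs => rw [this, hc1 _ (by omega)]
      have hv2 : ∀ i : Fin (m + 1), p + 1 ≤ (i : ℕ) → (u * c) i = i := by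
        intro i hi
        rw [Equiv.Perm.mul_apply, hc2 i hi, h2 i (by omega)]
      refine ⟨by omega, hv2, fun i j hij hj => ?_, fun i j hij hi => ?_⟩
      · have hj0 : j ≠ 0 := Fin.ne_zero_of_lt hij
        have hj0' : (j : ℕ) ≠ 0 := fun h => hj0 (Fin.ext h)
        rw [hv1 j hj0 (by omega)]
        by_cases hi : i = 0
        · rw [hi, hv0]
          exact hlt (by simp only; omega)
        · have hi0' : (i : ℕ) ≠ 0 := fun h => hi (Fin.ext h)
          rw [Fin.lt_def] at hij
          rw [hv1 i hi (by omega)]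
          exact h3 _ _ (by rw [Fin.lt_def]; simp only; omega) (by simp only; omega)
      · have hi0 : i ≠ 0 := fun h => by simp [h] at hi
        have hj0 : j ≠ 0 := Fin.ne_zero_of_lt hij
        rw [Fin.lt_def] at hij
        by_cases hj : (j : ℕ) ≤ p
        · rw [hv1 i hi0 (by omega), hv1 j hj0 hj]
          exact h4 _ _ (by rw [Fin.lt_def]; simp only; omega) (by simp only; omega)
        · rw [hv2 j (by omega)]
          by_cases hi' : (i : ℕ) ≤ p
          · rw [hv1 i hi0 hi', Fin.lt_def]
            have := hlt (i := ⟨i - 1, by omega⟩) (by simp only; omega)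
            omega
          · rwa [hv2 i (by omega)]

lemma disjoint_valleyPerms {m p k : ℕ} (hp : p ≤ m) : Disjoint (valleyPerms m p (k + 1))
    ((valleyPerms m p k).image (· * cgen (m + 1) (p + 1))) := by
  rw [Finset.disjoint_left]
  intro v hv hv'
  obtain ⟨u, hu, rfl⟩ := Finset.mem_image.1 hv'
  simp only [valleyPerms, Finset.mem_filter, Finset.mem_univ, true_and] at hu hv
  have h0 : cgen (m + 1) (p + 1) 0 = ⟨p, by omega⟩ := Fin.ext (by rw [cgen_apply hp]; simp)
  have h1 : (u * cgen (m + 1) (p + 1)) 0 = ⟨p, by omega⟩ := by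
    rw [Equiv.Perm.mul_apply, h0, hu.2.1 _ le_rfl]
  have h2 := hv.2.1 ⟨p, by omega⟩ le_rfl
  have h3 := congrArg Fin.val ((u * cgen (m + 1) (p + 1)).injective (h1.trans h2.symm))
  simp only [Fin.val_zero] at h3
  omega

lemma bplus_eq_sum_valleyPerms {m p : ℕ} (hp : p ≤ m + 1) (k : ℕ) :
    bplus (m + 1) p k
      = (-1 : ℂ) ^ k • ∑ v ∈ valleyPerms m p k, of ℂ (Equiv.Perm (Fin (m + 1))) v := by
  induction p generalizing k with
  | zero =>
    cases k with
    | zero => simp [bplus_zero_right, valleyPerms_zero_right, MonoidAlgebra.one_def]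
    | succ k => simp [bplus_zero_succ, valleyPerms_zero_succ]
  | succ p ih =>
    cases k with
    | zero => simp [bplus_zero_right, valleyPerms_zero_right, MonoidAlgebra.one_def]
    | succ k =>
      rw [bplus_succ_succ, ih (by omega), ih (by omega), valleyPerms_succ_succ (by omega),
        Finset.sum_union (disjoint_valleyPerms (by omega)),
        Finset.sum_image (mul_left_injective _).injOn, smul_mul_assoc, Finset.sum_mul]
      simp only [map_mul]
      rw [smul_add, pow_succ, mul_neg_one, neg_smul _ (∑ v ∈ valleyPerms m p k, _), sub_eq_add_neg]

lemma eulerIdem_mul_bplus {m k : ℕ} (h1 : 1 ≤ k) (h2 : k ≤ m) :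
    eulerIdem m * bplus (m + 1) (m + 1) k = 0 := by
  rw [bplus_eq_sum_valleyPerms le_rfl, mul_smul_comm]
  have h := eulerIdem_mul_sum_filter (m := m)
    (fun i j => (i < j ∧ k ≤ (i : ℕ)) ∨ (j < i ∧ (i : ℕ) < k))
    (fun i => (i : ℕ) < k) ⟨0, h1⟩ ⟨Fin.last m, by simpa using h2⟩ (by
      simp only [Fin.lt_def]
      omega)
  convert smul_zero _
  convert h using 3
  ext v
  simp only [valleyPerms, Finset.mem_filter, Finset.mem_univ, true_and]
  constructor
  · rintro ⟨-, -, h3, h4⟩ i j (⟨h5, h6⟩ | ⟨h5, h6⟩)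
    · exact h4 _ _ h5 h6
    · exact h3 _ _ h5 h6
  · intro h3
    refine ⟨by omega, fun i hi => absurd i.2 (by omega), fun i j h4 h5 => ?_, fun i j h4 h5 => ?_⟩
    · exact h3 _ _ (Or.inr ⟨h4, h5⟩)
    · exact h3 _ _ (Or.inl ⟨h4, h5⟩)

lemma eulerIdem_mul_cgen_pow {m k : ℕ} (hk : k ≤ m) :
    eulerIdem m * of ℂ (Equiv.Perm (Fin (m + 1))) (cgen (m + 1) (m + 1)) ^ k
      = eulerIdem m * bplus (m + 1) m k := by
  induction k with
  | zero => rw [pow_zero, bplus_zero_right]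
  | succ k ih =>
    have h := eulerIdem_mul_bplus (Nat.succ_pos k) hk
    rw [bplus_succ_succ, mul_sub, sub_eq_zero] at h
    rw [h, pow_succ, ← mul_assoc, ih (by omega), mul_assoc]

end Cycles

section Kernel

/-- The trace of left multiplication on a group algebra. -/
lemma trace_mulLeft {G : Type*} [Group G] [Fintype G] (x : MonoidAlgebra ℂ G) :
    LinearMap.trace ℂ _ (LinearMap.mulLeft ℂ x) = Fintype.card G * x.coeff 1 := by
  rw [LinearMap.trace_eq_matrix_trace ℂ (MonoidAlgebra.basis G ℂ), Matrix.trace]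
  have h : ∀ g : G, LinearMap.toMatrix (MonoidAlgebra.basis G ℂ) (MonoidAlgebra.basis G ℂ)
      (LinearMap.mulLeft ℂ x) g g = x.coeff 1 := by
    intro g
    rw [LinearMap.toMatrix_apply, LinearMap.mulLeft_apply, MonoidAlgebra.basis_apply]
    change (x * single g 1).coeff g = _
    rw [MonoidAlgebra.coeff_mul_single_eq_coeff_mul 1 (by simp), mul_one]
  simp only [Matrix.diag_apply, h, Finset.sum_const, Finset.card_univ, nsmul_eq_mul]

lemma eulerIdem_coeff_one (m : ℕ) : (eulerIdem m).coeff 1 = ((m : ℂ) + 1)⁻¹ := by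
  have h : ascCount (id : Fin (m + 1) → Fin (m + 1)) = m := by
    simp [ascCount]
  rw [← chPoly_self_coeff_one, eulerIdem, MonoidAlgebra.coeff_sum, Finsupp.finsetSum_apply,
    Finset.sum_eq_single 1]
  · simp [eulerCoeff, h]
  · intro w _ hw
    simp [hw]
  · simp

lemma finrank_range_eulerIdem (m : ℕ) :
    Module.finrank ℂ (LinearMap.range (LinearMap.mulLeft ℂ (eulerIdem m))) = m.factorial := by
  have h : IsIdempotentElem (LinearMap.mulLeft ℂ (eulerIdem m)) := by
    rw [IsIdempotentElem, Module.End.mul_eq_comp, ← LinearMap.mulLeft_mul, eulerIdem_mul_self]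
  have h1 := (LinearMap.IsIdempotentElem.isProj_range _ h).trace
  rw [trace_mulLeft, eulerIdem_coeff_one, Fintype.card_perm, Fintype.card_fin,
    Nat.factorial_succ] at h1
  have h2 : (m : ℂ) + 1 ≠ 0 := Nat.cast_add_one_ne_zero m
  push_cast at h1
  rw [mul_right_comm, mul_inv_cancel₀ h2, one_mul] at h1
  exact_mod_cast h1.symm

lemma mem_closure_sgen_iff {m : ℕ} {w : Equiv.Perm (Fin (m + 1))} :
    w ∈ Subgroup.closure {x | ∃ i, 1 ≤ i ∧ i ≤ m - 1 ∧ x = sgen (m + 1) i} ↔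
      w (Fin.last m) = Fin.last m := by
  constructor
  · intro h
    induction h using Subgroup.closure_induction with
    | mem x hx =>
      obtain ⟨i, h1, h2, rfl⟩ := hx
      rw [sgen_eq_adj h1 (by omega), adj, Equiv.swap_apply_of_ne_of_ne] <;>
        simp only [ne_eq, Fin.ext_iff, Fin.val_last, Fin.val_castSucc, Fin.val_succ] <;> omega
    | one => rfl
    | mul x y _ _ hx hy => rw [Equiv.Perm.mul_apply, hy, hx]
    | inv x _ hx => rw [Equiv.Perm.inv_eq_iff_eq, hx]
  · generalize hk : invCount w = k
    induction k using Nat.strong_induction_on generalizing w with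
    | _ k ih =>
      intro hw
      by_cases h1 : w = 1
      · rw [h1]
        exact one_mem _
      obtain ⟨j, hj⟩ : ∃ j : Fin m, w j.succ < w j.castSucc := by
        by_contra hcon
        push Not at hcon
        exact h1 (eq_one_of_forall_lt _ fun j =>
          (apply_castSucc_lt_or_gt w j).resolve_right (not_lt.2 (hcon j)))
      have h2 : j.succ ≠ Fin.last m := by
        intro h
        rw [h, hw] at hj
        exact absurd hj (not_lt.2 (Fin.le_last _))
      have h3 : adj j (Fin.last m) = Fin.last m :=
        Equiv.swap_apply_of_ne_of_ne (Fin.castSucc_lt_last j).ne' h2.symm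
      have h4 := invCount_mul_adj_of_gt _ _ hj
      have h5 := ih _ (by omega) rfl
        (show (w * adj j) (Fin.last m) = _ by rw [Equiv.Perm.mul_apply, h3, hw])
      rw [ne_eq, Fin.ext_iff, Fin.val_succ, Fin.val_last] at h2
      rw [← mul_inv_cancel_right w (adj j)]
      refine mul_mem h5 (inv_mem (Subgroup.subset_closure ⟨j + 1, by omega, ?_, ?_⟩))
      · have := j.2
        omega
      · exact (sgen_succ j).symm

lemma cgen_pow_apply_last {m k : ℕ} (hk : k ≤ m) :
    ((cgen (m + 1) (m + 1) ^ k) (Fin.last m) : ℕ) = m - k := by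
  induction k with
  | zero => simp
  | succ k ih =>
    have h := ih (by omega)
    rw [pow_succ', Equiv.Perm.mul_apply, cgen_apply le_rfl, h, if_neg (by omega), if_pos (by omega)]
    omega

/-- Every permutation is uniquely `c ^ k * w` with `0 ≤ k ≤ m` and `w` in the stabilizer of the
last point. -/
lemma exists_cgen_pow_mul {m : ℕ} {H : Subgroup (Equiv.Perm (Fin (m + 1)))}
    (hH : ∀ w, w ∈ H ↔ w (Fin.last m) = Fin.last m) (g : Equiv.Perm (Fin (m + 1))) :
    ∃ k ≤ m, ∃ w ∈ H, g = cgen (m + 1) (m + 1) ^ k * w := by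
  have h := (g (Fin.last m)).2
  refine ⟨m - g (Fin.last m), by omega, (cgen (m + 1) (m + 1) ^ (m - g (Fin.last m)))⁻¹ * g, ?_,
    (mul_inv_cancel_left _ _).symm⟩
  rw [hH, Equiv.Perm.mul_apply, Equiv.Perm.inv_eq_iff_eq]
  apply Fin.ext
  rw [cgen_pow_apply_last (by omega)]
  omega

lemma card_stabilizer_last {m : ℕ} {H : Subgroup (Equiv.Perm (Fin (m + 1)))}
    (hH : ∀ w, w ∈ H ↔ w (Fin.last m) = Fin.last m) : Fintype.card H = m.factorial := by
  have h : Function.Bijective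
      fun q : Fin (m + 1) × H => cgen (m + 1) (m + 1) ^ (q.1 : ℕ) * (q.2 : Equiv.Perm _) := by
    constructor
    · rintro ⟨k, w, hw⟩ ⟨k', w', hw'⟩ h
      simp only at h
      have h1 := congrArg (fun g : Equiv.Perm (Fin (m + 1)) => (g (Fin.last m) : ℕ)) h
      have h2 := k.2
      have h3 := k'.2
      simp only [Equiv.Perm.mul_apply] at h1
      rw [(hH w).1 hw, (hH w').1 hw', cgen_pow_apply_last (by omega),
        cgen_pow_apply_last (by omega)] at h1
      obtain rfl : k = k' := Fin.ext (by omega)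
      rw [mul_right_inj] at h
      subst h
      rfl
    · intro g
      obtain ⟨k, hk, w, hw, rfl⟩ := exists_cgen_pow_mul hH g
      exact ⟨(⟨k, by omega⟩, ⟨w, hw⟩), rfl⟩
  have h1 := Fintype.card_of_bijective h
  rw [Fintype.card_prod, Fintype.card_fin, Fintype.card_perm, Fintype.card_fin,
    Nat.factorial_succ] at h1
  exact Nat.eq_of_mul_eq_mul_left (Nat.succ_pos m) h1

lemma bplus_mul_mem_span {m k : ℕ} {H : Subgroup (Equiv.Perm (Fin (m + 1)))}
    (hH : ∀ w, w ∈ H ↔ w (Fin.last m) = Fin.last m) {w : Equiv.Perm (Fin (m + 1))} (hw : w ∈ H) :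
    bplus (m + 1) m k * of ℂ (Equiv.Perm (Fin (m + 1))) w ∈
      Submodule.span ℂ (Set.range fun w : H => of ℂ (Equiv.Perm (Fin (m + 1))) w) := by
  rw [bplus_eq_sum_valleyPerms (Nat.le_succ m), smul_mul_assoc, Finset.sum_mul]
  refine Submodule.smul_mem _ _ (Submodule.sum_mem _ fun v hv => ?_)
  have hv : v ∈ H := (hH v).2 ((Finset.mem_filter.1 hv).2.2.1 _ (by simp))
  exact Submodule.subset_span ⟨⟨v * w, mul_mem hv hw⟩, map_mul _ _ _⟩

lemma span_sup_span_eq_top {m : ℕ} {H : Subgroup (Equiv.Perm (Fin (m + 1)))}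
    (hH : ∀ w, w ∈ H ↔ w (Fin.last m) = Fin.last m) :
    Submodule.span ℂ (Set.range fun q : {k : ℕ // 1 ≤ k ∧ k ≤ m} × H =>
        ((of ℂ (Equiv.Perm (Fin (m + 1))) (cgen (m + 1) (m + 1))) ^ (q.1 : ℕ)
          - bplus (m + 1) m (q.1 : ℕ)) * of ℂ (Equiv.Perm (Fin (m + 1))) (q.2 : Equiv.Perm _)) ⊔
      Submodule.span ℂ (Set.range fun w : H => of ℂ (Equiv.Perm (Fin (m + 1))) w) = ⊤ := by
  rw [eq_top_iff, ← (MonoidAlgebra.basis (Equiv.Perm (Fin (m + 1))) ℂ).span_eq, Submodule.span_le]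
  rintro _ ⟨g, rfl⟩
  rw [MonoidAlgebra.basis_apply]
  change of ℂ (Equiv.Perm (Fin (m + 1))) g ∈ _
  obtain ⟨k, hk, w, hw, rfl⟩ := exists_cgen_pow_mul hH g
  by_cases hk0 : k = 0
  · rw [hk0, pow_zero, one_mul]
    exact Submodule.mem_sup_right (Submodule.subset_span ⟨⟨w, hw⟩, rfl⟩)
  · rw [map_mul, map_pow, ← sub_add_cancel (of ℂ (Equiv.Perm (Fin (m + 1)))
      (cgen (m + 1) (m + 1)) ^ k) (bplus (m + 1) m k), add_mul]
    exact Submodule.add_mem_sup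
      (Submodule.subset_span ⟨(⟨k, Nat.one_le_iff_ne_zero.2 hk0, hk⟩, ⟨w, hw⟩), rfl⟩)
      (bplus_mul_mem_span hH hw)

end Kernel

/-- Proposition 5.4(c),(d): with `c = c_n` and `e_n = e_S`, the kernel of left
multiplication by `e_n` on `ℂW` is the free right `ℂW_{n-1}`-module with basis
`{c^k − b⁺(n-1,k) : 1 ≤ k ≤ n-1}` (so the elements `(c^k − b⁺(n-1,k))·w`, for
`1 ≤ k ≤ n-1` and `w ∈ W_{n-1}`, form a `ℂ`-basis of the kernel); moreover the
elements `e_n w`, `w ∈ W_{n-1}`, form a `ℂ`-basis of `E_n = e_n ℂW`, so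
`a ↦ e_n a` is an isomorphism of right `ℂW_{n-1}`-modules `ℂW_{n-1} → E_n` and
`dim E_n = (n−1)!`. -/
theorem stmt13 (hn : 2 ≤ n)
    (e : Finset (Equiv.Perm (Fin n)) → MonoidAlgebra ℂ (Equiv.Perm (Fin n)))
    (he : IsBBHT n Set.univ (Simples n) e) :
    let Wn1 : Subgroup (Equiv.Perm (Fin n)) :=
      Subgroup.closure {x | ∃ i, 1 ≤ i ∧ i ≤ n - 2 ∧ x = sgen n i}
    let en := e (Simples n)
    let c := cgen n n
    let fam : {k : ℕ // 1 ≤ k ∧ k ≤ n - 1} × Wn1 → MonoidAlgebra ℂ (Equiv.Perm (Fin n)) :=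
      fun q => ((of ℂ (Equiv.Perm (Fin n)) c) ^ (q.1 : ℕ) - bplus n (n - 1) (q.1 : ℕ))
        * of ℂ (Equiv.Perm (Fin n)) (q.2 : Equiv.Perm (Fin n))
    LinearIndependent ℂ fam ∧
    Submodule.span ℂ (Set.range fam) = LinearMap.ker (LinearMap.mulLeft ℂ en) ∧
    LinearIndependent ℂ
      (fun w : Wn1 => en * of ℂ (Equiv.Perm (Fin n)) (w : Equiv.Perm (Fin n))) ∧
    Submodule.span ℂ
        (Set.range fun w : Wn1 => en * of ℂ (Equiv.Perm (Fin n)) (w : Equiv.Perm (Fin n)))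
      = LinearMap.range (LinearMap.mulLeft ℂ en) ∧
    Module.finrank ℂ (LinearMap.range (LinearMap.mulLeft ℂ en)) = Nat.factorial (n - 1) := by
  obtain ⟨m, rfl⟩ := Nat.exists_eq_add_of_le' (Nat.one_le_of_lt hn)
  intro Wn1 en c fam
  have hen : en = eulerIdem m := he.apply_Simples_eq
  have hH : ∀ w, w ∈ Wn1 ↔ w (Fin.last m) = Fin.last m := fun w => mem_closure_sgen_iff
  have hker : Submodule.span ℂ (Set.range fam) ≤ LinearMap.ker (LinearMap.mulLeft ℂ en) := by
    rw [Submodule.span_le]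
    rintro _ ⟨⟨⟨k, -, hk⟩, w⟩, rfl⟩
    have h := sub_eq_zero.2 (eulerIdem_mul_cgen_pow (m := m) hk)
    rw [← mul_sub] at h
    rw [SetLike.mem_coe, LinearMap.mem_ker, LinearMap.mulLeft_apply, ← mul_assoc, hen]
    exact (congrArg (· * _) h).trans (zero_mul _)
  have htop : Submodule.span ℂ (Set.range fam) ⊔ Submodule.span ℂ
      (Set.range fun w : Wn1 => of ℂ (Equiv.Perm (Fin (m + 1))) w) = ⊤ := span_sup_span_eq_top hH
  have hrange : Submodule.span ℂ
      (Set.range fun w : Wn1 => en * of ℂ (Equiv.Perm (Fin (m + 1))) w)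
        = LinearMap.range (LinearMap.mulLeft ℂ en) := by
    rw [LinearMap.range_eq_map, ← htop, Submodule.map_sup, LinearMap.le_ker_iff_map.1 hker,
      bot_sup_eq, Submodule.map_span, ← Set.range_comp]
    rfl
  have hdim : Module.finrank ℂ (LinearMap.range (LinearMap.mulLeft ℂ en)) = m.factorial := by
    rw [hen, finrank_range_eulerIdem]
  have hcard : Fintype.card Wn1 = m.factorial := card_stabilizer_last hH
  let _ : Fintype {k : ℕ // 1 ≤ k ∧ k ≤ m + 1 - 1} := Fintype.subtype (Finset.Icc 1 m) (by simp)
  have hidx : Fintype.card {k : ℕ // 1 ≤ k ∧ k ≤ m + 1 - 1} = m := by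
    rw [Fintype.subtype_card, Nat.card_Icc, Nat.add_sub_cancel]
  have hfin : Module.finrank ℂ (MonoidAlgebra ℂ (Equiv.Perm (Fin (m + 1))))
      = (m + 1) * m.factorial := by
    rw [Module.finrank_eq_card_basis (MonoidAlgebra.basis _ ℂ), Fintype.card_perm,
      Fintype.card_fin, Nat.factorial_succ]
  have : Module.Finite ℂ (MonoidAlgebra ℂ (Equiv.Perm (Fin (m + 1)))) :=
    Module.Finite.of_basis (MonoidAlgebra.basis _ ℂ)
  have hcard' : Fintype.card ({k : ℕ // 1 ≤ k ∧ k ≤ m + 1 - 1} × Wn1) = m * m.factorial := by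
    rw [Fintype.card_prod, hidx, hcard]
  have hker_dim : Module.finrank ℂ (LinearMap.ker (LinearMap.mulLeft ℂ en)) = m * m.factorial := by
    have := LinearMap.finrank_range_add_finrank_ker (LinearMap.mulLeft ℂ en)
    rw [hdim, hfin, add_mul, one_mul] at this
    omega
  have hspan_dim : m * m.factorial ≤ Module.finrank ℂ (Submodule.span ℂ (Set.range fam)) := by
    have h1 := Submodule.finrank_add_le_finrank_add_finrank (Submodule.span ℂ (Set.range fam))
      (Submodule.span ℂ (Set.range fun w : Wn1 => of ℂ (Equiv.Perm (Fin (m + 1))) w))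
    have h2 := finrank_range_le_card (R := ℂ) fun w : Wn1 => of ℂ (Equiv.Perm (Fin (m + 1))) w
    rw [htop, finrank_top, hfin, add_mul, one_mul] at h1
    rw [hcard, Set.finrank] at h2
    omega
  refine ⟨?_, Submodule.eq_of_le_of_finrank_le hker (hker_dim.le.trans hspan_dim), ?_, hrange, hdim⟩
  · rw [linearIndependent_iff_card_le_finrank_span, hcard']
    exact hspan_dim
  · rw [linearIndependent_iff_card_le_finrank_span, Set.finrank, hrange, hdim, hcard]

end DPRSym
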